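/- Let G be a finitely generated group with word-length |·| and polynomial volume growth of degree D. Let ℓ:[0,∞)→[0,∞) be a positive continuous increasing function, slowly varying at infinity, with ∫_1^∞ dt/(t ℓ(t)) < ∞. Set θ(s) = 1/∫_0^{1/s} dt/(t ℓ(1/t)) and θ₂(s) = (1/2)θ(s²). Let φ be a symmetric probability measure on G with φ(g) ≃ 1/((1+|g|)^D ℓ(1+|g|²)). Then Φ̃_{G,θ₂}(n) ≃ φ^{(n)}(e), i.e. there exist constants c, C, N, M > 0 with c·φ^{(2Nn)}(e) ≤ Φ̃_{G,θ₂}(n) ≤ C·φ^{(2n/M)}(e) for all n. -/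

import Mathlib

open MeasureTheory Filter Topology Set
open scoped Classical BigOperators

noncomputable section

/-- Word length of `g` with respect to a set `S` of generators. -/
def wordLen {G : Type*} [Group G] (S : Set G) (g : G) : ℕ :=
  sInf {n | ∃ w : List G, (∀ x ∈ w, x ∈ S) ∧ w.length = n ∧ w.prod = g}

/-- The symmetric set associated with a generating tuple. -/
def symSet {G : Type*} [Group G] {k : ℕ} (s : Fin k → G) : Set G :=
  {x | ∃ i, x = s i ∨ x = (s i)⁻¹}

/-- Volume function: number of elements of word length at most `n`. -/
def vol {G : Type*} [Group G] (S : Set G) (n : ℕ) : ℕ :=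
  Set.ncard {g : G | wordLen S g ≤ n}

/-- `S` is a finite symmetric generating set. -/
def IsSymmGen {G : Type*} [Group G] (S : Set G) : Prop :=
  S.Finite ∧ (∀ x ∈ S, x⁻¹ ∈ S) ∧ Subgroup.closure S = ⊤

/-- Polynomial volume growth of degree `D`. -/
def PolyGrowth {G : Type*} [Group G] (S : Set G) (D : ℕ) : Prop :=
  ∃ c C : ℝ, 0 < c ∧ 0 < C ∧ ∀ n : ℕ, 1 ≤ n →
    c * (n : ℝ) ^ D ≤ (vol S n : ℝ) ∧ (vol S n : ℝ) ≤ C * (n : ℝ) ^ D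

/-- A symmetric probability measure on `G`, viewed as a density. -/
def IsSymmProb {G : Type*} [Group G] (μ : G → ℝ) : Prop :=
  (∀ g, 0 ≤ μ g) ∧ Summable μ ∧ (∑' g, μ g) = 1 ∧ (∀ g, μ g⁻¹ = μ g)

/-- Convolution of two densities on `G`. -/
def conv {G : Type*} [Group G] (μ ν : G → ℝ) : G → ℝ :=
  fun g => ∑' h, μ h * ν (h⁻¹ * g)

/-- Convolution powers `μ^{(n)}`. -/
def convPow {G : Type*} [Group G] (μ : G → ℝ) : ℕ → G → ℝ
  | 0 => fun g => if g = 1 then 1 else 0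
  | n + 1 => conv μ (convPow μ n)

/-- Mass a density gives to a set. -/
def massOf {G : Type*} (μ : G → ℝ) (A : Set G) : ℝ := ∑' g : A, μ (g : G)

/-- The weak `ρ`-moment of `μ` is bounded by `M`:
`sup_{s>0} s·μ({g : ρ(|g|) > s}) ≤ M`. -/
def WeakMomentLe {G : Type*} [Group G] (S : Set G) (ρ : ℝ → ℝ) (μ : G → ℝ) (M : ℝ) : Prop :=
  ∀ s : ℝ, 0 < s → s * massOf μ {g | ρ ((wordLen S g : ℝ)) > s} ≤ M

/-- `Φ̃_{G,ρ}(n)`: fastest decay of `φ^{(2n)}(e)` under the weak `ρ`-moment condition. -/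
def PhiTilde {G : Type*} [Group G] (S : Set G) (ρ : ℝ → ℝ) (n : ℕ) : ℝ :=
  sInf {x | ∃ μ : G → ℝ, IsSymmProb μ ∧ WeakMomentLe S ρ μ 2 ∧ x = convPow μ (2 * n) 1}

/-- Slow variation at infinity. -/
def SlowlyVarying (l : ℝ → ℝ) : Prop :=
  ∀ lam : ℝ, 0 < lam → Tendsto (fun x => l (lam * x) / l x) atTop (nhds 1)

/-- `ls` is a de Bruijn conjugate of the slowly varying function `l`. -/
def IsDeBruijnConjugate (l ls : ℝ → ℝ) : Prop :=
  SlowlyVarying ls ∧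
  Tendsto (fun x => l x * ls (x * l x)) atTop (nhds 1) ∧
  Tendsto (fun x => ls x * l (x * ls x)) atTop (nhds 1)

/-- Iterated logarithms: `log_{[0]} x = x`, `log_{[j]} x = log(1 + log_{[j-1]} x)`. -/
def logIter : ℕ → ℝ → ℝ
  | 0, x => x
  | n + 1, x => Real.log (1 + logIter n x)

/-- Base 2 iterated logarithms: `log_{2,1}(s) = log₂(1+s)`, `log_{2,j} = log_{2,1} ∘ log_{2,j-1}`. -/
def log2Iter : ℕ → ℝ → ℝ
  | 0, x => x
  | n + 1, x => Real.logb 2 (1 + log2Iter n x)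

/-- `θ(s) = 1/∫_0^{1/s} dt/(t ℓ(1/t))`. -/
def thetaOf (l : ℝ → ℝ) (s : ℝ) : ℝ :=
  1 / ∫ t in Set.Ioc (0:ℝ) (1/s), 1 / (t * l (1/t))

/-- Dirichlet form `E_μ(f,f) = (1/2) Σ_{x,y} |f(xy)-f(x)|² μ(y)`. -/
def dirichlet {G : Type*} [Group G] (μ : G → ℝ) (f : G → ℝ) : ℝ :=
  (1/2) * ∑' p : G × G, |f (p.1 * p.2) - f p.1| ^ 2 * μ p.2

/-- `f ∈ ℓ²(G)` (counting measure). -/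
def MemL2 {G : Type*} (f : G → ℝ) : Prop := Summable (fun x => (f x) ^ 2)

/-- Bernstein representation `ψ(s) = a + bs + ∫ (1-e^{-st}) dν(t)`,
with `ν` supported in `(0,∞)` and `∫ t/(1+t) dν < ∞`. -/
def IsBernsteinRep (ψ : ℝ → ℝ) (a b : ℝ) (ν : Measure ℝ) : Prop :=
  0 ≤ a ∧ 0 ≤ b ∧ ν (Set.Iic 0) = 0 ∧
  Integrable (fun t => t / (1 + t)) ν ∧
  ∀ s : ℝ, 0 < s → ψ s = a + b * s + ∫ t, (1 - Real.exp (-(s * t))) ∂ν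

/-- Bernstein function (via the classical representation). -/
def IsBernstein (ψ : ℝ → ℝ) : Prop := ∃ a b ν, IsBernsteinRep ψ a b ν

/-- Complete Bernstein function: `ψ(s) = s² ∫_0^∞ e^{-ts} g(t) dt` with `g` Bernstein. -/
def IsCompleteBernstein (ψ : ℝ → ℝ) : Prop :=
  ∃ g : ℝ → ℝ, IsBernstein g ∧
    ∀ s : ℝ, 0 < s → ψ s = s ^ 2 * ∫ t in Set.Ioi (0:ℝ), Real.exp (-(t * s)) * g t

/-- Subordination coefficients `c(ψ,n)` computed from representation data `(b,ν)`:
`c(ψ,1) = b + ∫ t e^{-t} dν`, `c(ψ,n) = (1/n!) ∫ tⁿ e^{-t} dν` for `n > 1`. -/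
def cPsi (b : ℝ) (ν : Measure ℝ) (n : ℕ) : ℝ :=
  if n = 0 then 0
  else (if n = 1 then b else 0) + (1 / (n.factorial : ℝ)) * ∫ t, t ^ n * Real.exp (-t) ∂ν

/-- Subordinated measure `Σ_{n} c(n) φ^{(n)}`. -/
def subord {G : Type*} [Group G] (φ : G → ℝ) (c : ℕ → ℝ) : G → ℝ :=
  fun x => ∑' n : ℕ, c n * convPow φ n x

/-- Tail `H_φ(r) = Σ_{|n|>r} φ(n)` of a measure on `ℤ`. -/
def Hphi (φ : ℤ → ℝ) (r : ℝ) : ℝ := ∑' n : ℤ, if r < (|n| : ℝ) then φ n else 0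

/-- Truncated second moment `G_φ(r) = Σ_{|n|≤r} n² φ(n)`. -/
def Gphi (φ : ℤ → ℝ) (r : ℝ) : ℝ := ∑' n : ℤ, if (|n| : ℝ) ≤ r then (n : ℝ) ^ 2 * φ n else 0

/-- `E_{s,φ}(f,f) = (1/2) Σ_{x∈G} Σ_{n∈ℤ} |f(xsⁿ)-f(x)|² φ(n)`. -/
def EsPhi {G : Type*} [Group G] (s : G) (φ : ℤ → ℝ) (f : G → ℝ) : ℝ :=
  (1/2) * ∑' p : G × ℤ, |f (p.1 * s ^ p.2) - f p.1| ^ 2 * φ p.2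

/-- Symmetric probability measure on `ℤ`. -/
def IsSymmProbZ (φ : ℤ → ℝ) : Prop :=
  (∀ n, 0 ≤ φ n) ∧ Summable φ ∧ (∑' n, φ n) = 1 ∧ (∀ n, φ (-n) = φ n)

/-- Measure supported on powers of generators:
`μ(g) = k⁻¹ Σ_i Σ_{n∈ℤ} w(n) 1_{s_iⁿ}(g)`. -/
def genMeasure {G : Type*} [Group G] {k : ℕ} (s : Fin k → G) (w : ℤ → ℝ) : G → ℝ :=
  fun g => (k : ℝ)⁻¹ * ∑ i : Fin k, ∑' n : ℤ, if g = s i ^ n then w n else 0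

/-- Coefficients in `1-(1-x)^α = Σ_{n≥1} c_α(n) xⁿ`. -/
def cAlpha (a : ℝ) (n : ℕ) : ℝ :=
  if n = 0 then 0
  else (-1) ^ (n + 1) * (∏ j ∈ Finset.range n, (a - j)) / (n.factorial : ℝ)
/-! ### Convolution of nonnegative summable functions -/

structure Good {G : Type*} (f : G → ℝ) : Prop where
  nn : ∀ g, 0 ≤ f g
  sm : Summable f

lemma Good.le_tsum {G : Type*} {f : G → ℝ} (hf : Good f) (g : G) : f g ≤ ∑' x, f x :=
  hf.sm.le_tsum g (fun j _ => hf.nn j)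

lemma Good.tsum_nn {G : Type*} {f : G → ℝ} (hf : Good f) : 0 ≤ ∑' x, f x :=
  tsum_nonneg hf.nn

lemma Good.mono {G : Type*} {f h : G → ℝ} (hh : Good h) (h0 : ∀ g, 0 ≤ f g)
    (hle : ∀ g, f g ≤ h g) : Good f :=
  ⟨h0, Summable.of_nonneg_of_le h0 hle hh.sm⟩

def shearEquiv (G : Type*) [Group G] : G × G ≃ G × G where
  toFun p := (p.1, p.1⁻¹ * p.2)
  invFun p := (p.1, p.1 * p.2)
  left_inv p := by simp
  right_inv p := by simp

section convs
variable {G : Type*} [Group G] {f h k : G → ℝ}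

lemma shear_summable (hf : Good f) (hh : Good h) :
    Summable (fun p : G × G => f p.1 * h (p.1⁻¹ * p.2)) := by
  have h1 : Summable (fun p : G × G => f p.1 * h p.2) :=
    hf.sm.mul_of_nonneg hh.sm hf.nn hh.nn
  exact (shearEquiv G).summable_iff.mpr h1

lemma conv_sm (hf : Good f) (hh : Good h) (g : G) :
    Summable (fun x => f x * h (x⁻¹ * g)) := by
  refine Summable.of_nonneg_of_le (fun x => mul_nonneg (hf.nn _) (hh.nn _))
    (fun x => mul_le_mul_of_nonneg_left (hh.le_tsum (x⁻¹ * g)) (hf.nn x)) (hf.sm.mul_right _)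

lemma conv_nn (hf : ∀ g, 0 ≤ f g) (hh : ∀ g, 0 ≤ h g) (g : G) : 0 ≤ conv f h g :=
  tsum_nonneg (fun x => mul_nonneg (hf _) (hh _))

lemma conv_good (hf : Good f) (hh : Good h) : Good (conv f h) := by
  refine ⟨conv_nn hf.nn hh.nn, ?_⟩
  have h1 := (shear_summable hf hh).prod_symm
  exact h1.prod

lemma tsum_conv (hf : Good f) (hh : Good h) :
    ∑' g, conv f h g = (∑' g, f g) * ∑' g, h g := by
  have h1 := shear_summable hf hh
  have e1 : ∑' g, conv f h g = ∑' p : G × G, f p.1 * h (p.1⁻¹ * p.2) := by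
    rw [← (Equiv.prodComm G G).tsum_eq]
    exact (h1.prod_symm.tsum_prod).symm
  rw [e1, h1.tsum_prod, ← tsum_mul_right]
  congr 1; ext x
  simp only
  rw [tsum_mul_left]
  congr 1
  exact (Equiv.mulLeft x⁻¹).tsum_eq h

lemma conv_mono {f' h' : G → ℝ} (hf' : Good f') (hh' : Good h')
    (hf : ∀ g, 0 ≤ f g) (hh : ∀ g, 0 ≤ h g)
    (h1 : ∀ g, f g ≤ f' g) (h2 : ∀ g, h g ≤ h' g) (g : G) : conv f h g ≤ conv f' h' g := by
  refine Summable.tsum_le_tsum (fun x => mul_le_mul (h1 _) (h2 _) (hh _) (hf'.nn _)) ?_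
    (conv_sm hf' hh' g)
  exact conv_sm (hf'.mono hf h1) (hh'.mono hh h2) g

lemma conv_assoc (hf : Good f) (hh : Good h) (hk : Good k) :
    conv f (conv h k) = conv (conv f h) k := by
  ext g
  unfold conv
  have e1 : ∀ x, f x * ∑' y, h y * k (y⁻¹ * (x⁻¹ * g)) =
      ∑' z, f x * h (x⁻¹ * z) * k (z⁻¹ * g) := by
    intro x
    rw [← (Equiv.mulLeft x⁻¹).tsum_eq, ← tsum_mul_left]
    congr 1; ext z
    simp [mul_assoc]
  have e2 : ∀ z, (∑' x, f x * h (x⁻¹ * z)) * k (z⁻¹ * g) =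
      ∑' x, f x * h (x⁻¹ * z) * k (z⁻¹ * g) := fun z => tsum_mul_right.symm
  simp only [e1, e2]
  refine (Summable.tsum_comm (f := fun x z => f x * h (x⁻¹ * z) * k (z⁻¹ * g)) ?_).symm
  refine Summable.of_nonneg_of_le (fun p => ?_) (fun p => ?_)
    ((shear_summable hf hh).mul_right (∑' x, k x))
  · exact mul_nonneg (mul_nonneg (hf.nn _) (hh.nn _)) (hk.nn _)
  · exact mul_le_mul_of_nonneg_left (hk.le_tsum _) (mul_nonneg (hf.nn _) (hh.nn _))

lemma delta_good : Good (convPow f 0) := by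
  refine ⟨fun g => ?_, ?_⟩
  · simp only [convPow]; split_ifs <;> norm_num
  · exact summable_of_ne_finset_zero (s := {1}) (fun b hb => by simp_all [convPow])

lemma tsum_delta : ∑' g, convPow f 0 g = 1 := by
  simp only [convPow]
  exact tsum_ite_eq 1 _

lemma convPow_good (hf : Good f) : ∀ n, Good (convPow f n)
  | 0 => delta_good
  | n + 1 => conv_good hf (convPow_good hf n)

lemma tsum_convPow (hf : Good f) : ∀ n, ∑' g, convPow f n g = (∑' g, f g) ^ n
  | 0 => by rw [tsum_delta, pow_zero]
  | n + 1 => by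
    rw [pow_succ', ← tsum_convPow hf n]
    exact tsum_conv hf (convPow_good hf n)

lemma convPow_mono (hh : Good h) (hf : ∀ g, 0 ≤ f g) (hle : ∀ g, f g ≤ h g) :
    ∀ n g, convPow f n g ≤ convPow h n g
  | 0, _ => le_rfl
  | n + 1, g => conv_mono hh (convPow_good hh n) hf (convPow_good (hh.mono hf hle) n).nn hle
      (convPow_mono hh hf hle n) g

lemma delta_conv : conv (convPow f 0) h = h := by
  ext g
  unfold conv
  rw [tsum_eq_single 1]
  · simp [convPow]
  · intro b hb; simp [convPow, hb]

lemma conv_delta : conv h (convPow f 0) = h := by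
  ext g
  unfold conv
  rw [tsum_eq_single g]
  · simp [convPow]
  · intro b hb
    have : b⁻¹ * g ≠ 1 := by
      intro h; apply hb; rw [inv_mul_eq_one] at h; exact h
    simp [convPow, this]

lemma convPow_add (hf : Good f) (m n : ℕ) :
    convPow f (m + n) = conv (convPow f m) (convPow f n) := by
  induction m with
  | zero => rw [Nat.zero_add, delta_conv]
  | succ m ih =>
    have : convPow f (m + 1 + n) = conv f (convPow f (m + n)) := by
      rw [show m + 1 + n = (m + n) + 1 by ring]; rfl
    rw [this, ih, conv_assoc hf (convPow_good hf m) (convPow_good hf n)]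
    rfl

lemma convPow_succ' (hf : Good f) (n : ℕ) :
    convPow f (n + 1) = conv (convPow f n) f := by
  rw [convPow_add hf n 1]
  congr 1
  change conv f (convPow f 0) = f
  exact conv_delta

lemma conv_inv (f h : G → ℝ) (hf : ∀ g, f g⁻¹ = f g) (hh : ∀ g, h g⁻¹ = h g) (g : G) :
    conv f h g⁻¹ = conv h f g := by
  unfold conv
  rw [← (Equiv.mulLeft g⁻¹).tsum_eq]
  congr 1; ext y
  simp only [Equiv.coe_mulLeft]
  rw [← hf (g⁻¹ * y), ← hh y, mul_comm]
  simp [mul_assoc]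

lemma convPow_inv (hf : Good f) (hs : ∀ g, f g⁻¹ = f g) : ∀ n g, convPow f n g⁻¹ = convPow f n g
  | 0, g => by simp [convPow]
  | n + 1, g => by
    have := conv_inv f (convPow f n) hs (convPow_inv hf hs n) g
    rw [convPow_succ' hf n, ← this, ← convPow_succ' hf n]
    rfl

/-- Cauchy-Schwarz lower bound for the return probability. -/
lemma return_lower (hf : Good f) (hs : ∀ g, f g⁻¹ = f g) (n : ℕ) (B : Finset G) (x : ℝ)
    (hx0 : 0 ≤ x) (hx : x ≤ ∑ g ∈ B, convPow f n g) :
    x ^ 2 ≤ B.card * convPow f (2 * n) 1 := by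
  have h1 : ∑ g ∈ B, (convPow f n g) ^ 2 ≤ convPow f (2 * n) 1 := by
    rw [two_mul, convPow_add hf n n]
    have := (conv_sm (convPow_good hf n) (convPow_good hf n) 1).sum_le_tsum B
      (fun i _ => mul_nonneg ((convPow_good hf n).nn _) ((convPow_good hf n).nn _))
    refine le_trans (le_of_eq ?_) this
    refine Finset.sum_congr rfl (fun y _ => ?_)
    rw [mul_one, convPow_inv hf hs, sq]
  calc x ^ 2 ≤ (∑ g ∈ B, convPow f n g) ^ 2 := by gcongr
    _ ≤ B.card * ∑ g ∈ B, (convPow f n g) ^ 2 := sq_sum_le_card_mul_sum_sq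
    _ ≤ _ := by gcongr

/-- Difference lemma: comparing powers of `f ≤ h`. -/
lemma convPow_diff (hf : Good f) (hh : Good h) (hle : ∀ g, f g ≤ h g) (H : ℝ) (hH : 0 ≤ H)
    (hd : ∀ g, h g - f g ≤ H * (∑' x, h x - ∑' x, f x)) :
    ∀ n g, convPow h n g ≤ convPow f n g + H * (∑' x, h x) ^ n
  | 0, g => by
    have : convPow h 0 g = convPow f 0 g := rfl
    rw [this]; simpa using hH
  | n + 1, g => by
    have ih := convPow_diff hf hh hle H hH hd n
    have gh := convPow_good hh n
    have gf := convPow_good hf n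
    set p := ∑' x, h x
    set q := ∑' x, f x
    have hqp : q ≤ p := Summable.tsum_le_tsum hle hf.sm hh.sm
    have hp : 0 ≤ p := hh.tsum_nn
    have s1 := conv_sm hf gf g
    have s2 : Summable (fun x => f x * (H * p ^ n)) := hf.sm.mul_right _
    have s3 : Summable (fun x => (H * (p - q)) * convPow h n (x⁻¹ * g)) := by
      refine Summable.mul_left _ ?_
      have e := ((Equiv.inv G).trans (Equiv.mulRight g)).summable_iff.mpr gh.sm
      exact e
    have t3 : ∑' x, (H * (p - q)) * convPow h n (x⁻¹ * g) = H * (p - q) * p ^ n := by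
      rw [tsum_mul_left, ← tsum_convPow hh n]
      congr 1
      exact ((Equiv.inv G).trans (Equiv.mulRight g)).tsum_eq (convPow h n)
    have hpt : ∀ x, h x * convPow h n (x⁻¹ * g) ≤
        f x * convPow f n (x⁻¹ * g) + f x * (H * p ^ n)
          + (H * (p - q)) * convPow h n (x⁻¹ * g) := by
      intro x
      have a1 := mul_le_mul_of_nonneg_left (ih (x⁻¹ * g)) (hf.nn x)
      have a2 := mul_le_mul_of_nonneg_right (hd x) (gh.nn (x⁻¹ * g))
      nlinarith
    calc convPow h (n + 1) g = ∑' x, h x * convPow h n (x⁻¹ * g) := rfl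
      _ ≤ ∑' x, (f x * convPow f n (x⁻¹ * g) + f x * (H * p ^ n)
          + (H * (p - q)) * convPow h n (x⁻¹ * g)) :=
        Summable.tsum_le_tsum hpt (conv_sm hh gh g) ((s1.add s2).add s3)
      _ = convPow f (n + 1) g + q * (H * p ^ n) + H * (p - q) * p ^ n := by
        rw [(s1.add s2).tsum_add s3, s1.tsum_add s2, t3, tsum_mul_right]
        rfl
      _ = _ := by ring

/-- First moment of convolution powers. -/
lemma convPow_moment (len : G → ℕ) (hl1 : len 1 = 0) (hlm : ∀ x y, len (x * y) ≤ len x + len y)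
    (hf : Good f) (hf1 : Summable (fun g => (len g : ℝ) * f g)) :
    ∀ n, Summable (fun g => (len g : ℝ) * convPow f n g) ∧
      (∑' g, f g) * ∑' g, (len g : ℝ) * convPow f n g ≤
        n * (∑' g, (len g : ℝ) * f g) * (∑' g, f g) ^ n
  | 0 => by
    have : (fun g => (len g : ℝ) * convPow f 0 g) = fun _ => 0 := by
      ext g
      simp only [convPow]
      split_ifs with hg
      · simp [hg, hl1]
      · simp
    rw [this]
    simp [summable_zero]
  | n + 1 => by
    obtain ⟨ih1, ih2⟩ := convPow_moment len hl1 hlm hf hf1 n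
    have gf := convPow_good hf n
    have g1 : Good (fun g => (len g : ℝ) * f g) :=
      ⟨fun g => mul_nonneg (Nat.cast_nonneg _) (hf.nn g), hf1⟩
    have g2 : Good (fun g => (len g : ℝ) * convPow f n g) :=
      ⟨fun g => mul_nonneg (Nat.cast_nonneg _) (gf.nn g), ih1⟩
    have c1 := conv_good g1 gf
    have c2 := conv_good hf g2
    have hpt : ∀ g, (len g : ℝ) * convPow f (n + 1) g ≤
        conv (fun g => (len g : ℝ) * f g) (convPow f n) g
          + conv f (fun g => (len g : ℝ) * convPow f n g) g := by
      intro g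
      change (len g : ℝ) * ∑' x, f x * convPow f n (x⁻¹ * g) ≤ _
      rw [← tsum_mul_left]
      unfold conv
      rw [← (conv_sm g1 gf g).tsum_add (conv_sm hf g2 g)]
      refine Summable.tsum_le_tsum (fun x => ?_) ((conv_sm hf gf g).mul_left _)
        ((conv_sm g1 gf g).add (conv_sm hf g2 g))
      have h1 : (len g : ℝ) ≤ len x + len (x⁻¹ * g) := by
        have := hlm x (x⁻¹ * g)
        rw [mul_inv_cancel_left] at this
        exact_mod_cast this
      have h2 := mul_le_mul_of_nonneg_right h1 (mul_nonneg (hf.nn x) (gf.nn (x⁻¹ * g)))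
      linarith
    have sm : Summable (fun g => (len g : ℝ) * convPow f (n + 1) g) :=
      Summable.of_nonneg_of_le
        (fun g => mul_nonneg (Nat.cast_nonneg _) ((convPow_good hf (n+1)).nn g)) hpt
        (c1.sm.add c2.sm)
    refine ⟨sm, ?_⟩
    have hle := Summable.tsum_le_tsum hpt sm (c1.sm.add c2.sm)
    rw [c1.sm.tsum_add c2.sm, tsum_conv g1 gf, tsum_conv hf g2, tsum_convPow hf n] at hle
    have hp := hf.tsum_nn
    set p := ∑' g, f g
    set E := ∑' g, (len g : ℝ) * f g
    have := mul_le_mul_of_nonneg_left hle hp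
    have h3 := mul_le_mul_of_nonneg_left ih2 hp
    push_cast
    calc _ ≤ _ := this
      _ ≤ p * (E * p ^ n) + p * (n * E * p ^ n) := by linarith
      _ = _ := by ring

end convs
/-! ### Lower bound -/

lemma karamata_aux (q : ℕ) (hq : 4 ≤ q) (I : ℕ → ℝ) (hI : ∀ j, 0 < I j) (j0 : ℕ)
    (hdb : ∀ j, j0 ≤ j → I j ≤ 2 * I (j + 1)) (B : ℝ) (hB : 0 < B) :
    ∃ C2 : ℝ, 0 < C2 ∧ ∀ k, j0 ≤ k →
      1 + ∑ j ∈ Finset.range k, (q : ℝ) ^ (j + 1) * (B * I j) ≤ C2 * ((q : ℝ) ^ k * I k) := by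
  have hq0 : (4 : ℝ) ≤ q := by exact_mod_cast hq
  set M : ℕ → ℝ := fun k => 1 + ∑ j ∈ Finset.range k, (q : ℝ) ^ (j + 1) * (B * I j) with hM
  refine ⟨max (2 * q * B) (M j0 / ((q : ℝ) ^ j0 * I j0)), lt_max_of_lt_left (by positivity), ?_⟩
  set C2 := max (2 * q * B) (M j0 / ((q : ℝ) ^ j0 * I j0)) with hC2
  have hC2a : 2 * q * B ≤ C2 := le_max_left _ _
  have hC20 : 0 < C2 := lt_of_lt_of_le (by positivity) hC2a
  intro k hk
  induction k, hk using Nat.le_induction with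
  | base =>
    have : M j0 / ((q : ℝ) ^ j0 * I j0) ≤ C2 := le_max_right _ _
    rw [div_le_iff₀ (by have := hI j0; positivity)] at this
    exact this
  | succ k hk ih =>
    rw [Finset.sum_range_succ, ← add_assoc]
    have h1 : (q : ℝ) ^ (k + 1) * (B * I k) ≤ (C2 / 2) * ((q : ℝ) ^ k * I k) := by
      have : (q : ℝ) ^ (k + 1) * (B * I k) = (q * B) * ((q : ℝ) ^ k * I k) := by ring
      rw [this]
      have := hI k
      gcongr
      linarith
    have h2 : (q : ℝ) ^ k * I k ≤ (q : ℝ) ^ k * (2 * I (k + 1)) := by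
      gcongr
      exact hdb k hk
    have h3 : (0:ℝ) < (q : ℝ) ^ k * I (k + 1) := by have := hI (k+1); positivity
    calc _ ≤ C2 * ((q : ℝ) ^ k * I k) + (C2 / 2) * ((q : ℝ) ^ k * I k) := by linarith
      _ = (3 / 2 * C2) * ((q : ℝ) ^ k * I k) := by ring
      _ ≤ (3 / 2 * C2) * ((q : ℝ) ^ k * (2 * I (k + 1))) := by gcongr
      _ = C2 * (3 * ((q : ℝ) ^ k * I (k + 1))) := by ring
      _ ≤ C2 * (q * ((q : ℝ) ^ k * I (k + 1))) := by gcongr; linarith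
      _ = _ := by ring

lemma exp_neg_two_mul_le {x : ℝ} (h0 : 0 ≤ x) (h1 : x ≤ 1 / 2) : Real.exp (-(2 * x)) ≤ 1 - x := by
  rw [Real.exp_neg]
  have h2 := Real.add_one_le_exp (2 * x)
  rw [inv_le_comm₀ (Real.exp_pos _) (by linarith)]
  refine le_trans ?_ h2
  rw [inv_le_iff_one_le_mul₀ (by linarith)]
  nlinarith

lemma good_ite {G : Type*} {f : G → ℝ} (hf : Good f) (P : G → Prop) [DecidablePred P] :
    Good (fun g => if P g then f g else 0) := by
  refine hf.mono (fun g => ?_) (fun g => ?_)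
  · split_ifs
    · exact hf.nn g
    · exact le_rfl
  · split_ifs
    · exact le_rfl
    · exact hf.nn g

lemma lower_bound {G : Type*} [Group G] (len : G → ℕ) (hl1 : len 1 = 0)
    (hlm : ∀ x y, len (x * y) ≤ len x + len y) (D : ℕ) (CV : ℝ) (hCV : 0 < CV)
    (hV : ∀ R : ℕ, 1 ≤ R → ∃ Bs : Finset G, (∀ g, g ∈ Bs ↔ len g ≤ R) ∧
      (Bs.card : ℝ) ≤ CV * (R : ℝ) ^ D)
    (q : ℕ) (hq : 4 ≤ q) (I : ℕ → ℝ) (hI : ∀ j, 0 < I j) (hI0 : Tendsto I atTop (𝓝 0))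
    (j0 : ℕ) (hdb : ∀ j, j0 ≤ j → I j ≤ 2 * I (j + 1)) (B : ℝ) (hB : 0 < B) :
    ∃ c1 C1 : ℝ, ∃ k0 : ℕ, 0 < c1 ∧ 0 < C1 ∧ ∀ μ : G → ℝ, Good μ → (∑' g, μ g = 1) →
      (∀ g, μ g⁻¹ = μ g) →
      (∀ j, ∑' g, (if q ^ j < len g then μ g else 0) ≤ B * I j) →
      ∀ k, k0 ≤ k → ∀ n : ℕ,
        c1 * (((q : ℝ) ^ (k * D))⁻¹ * Real.exp (-(C1 * (n * I k)))) ≤ convPow μ (2 * n) 1 := by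
  obtain ⟨C2, hC2, hkar⟩ := karamata_aux q hq I hI j0 hdb B hB
  have hq0 : (4 : ℝ) ≤ q := by exact_mod_cast hq
  have hev : ∀ᶠ k in atTop, I k < 1 / (2 * B) := hI0.eventually_lt_const (by positivity)
  obtain ⟨k1, hk1⟩ := eventually_atTop.mp hev
  refine ⟨1 / (4 * CV * 2 ^ D), 4 * B + 2 * C2 * D, max j0 k1, by positivity, by positivity, ?_⟩
  intro μ hμ hμ1 hμs htail k hk n
  have hkj := (le_max_left _ _).trans hk
  have hBI : B * I k ≤ 1 / 2 := by
    have := (hk1 k ((le_max_right _ _).trans hk)).le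
    rw [le_div_iff₀ (by positivity)] at this
    linarith
  have hBI0 : 0 < B * I k := mul_pos hB (hI k)
  set ν : G → ℝ := fun g => if len g ≤ q ^ k then μ g else 0 with hν
  have gν : Good ν := good_ite hμ _
  have νle : ∀ g, ν g ≤ μ g := by
    intro g; simp only [hν]; split_ifs
    · exact le_rfl
    · exact hμ.nn g
  set p := ∑' g, ν g with hp
  have hsplit : p + ∑' g, (if q ^ k < len g then μ g else 0) = 1 := by
    rw [hp, ← gν.sm.tsum_add (good_ite hμ _).sm, ← hμ1]
    congr 1; ext g
    simp only [hν]
    by_cases h : len g ≤ q ^ k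
    · simp [h, not_lt.mpr h]
    · simp [h, not_le.mp h]
  have hpge : 1 - B * I k ≤ p := by have := htail k; linarith
  have hphalf : 1 / 2 ≤ p := by linarith
  have hpexp : Real.exp (-(2 * (B * I k))) ≤ p := (exp_neg_two_mul_le hBI0.le hBI).trans hpge
  -- first moment
  have hpt : ∀ g, (len g : ℝ) * ν g ≤ μ g + ∑ j ∈ Finset.range k,
      (q : ℝ) ^ (j + 1) * (if q ^ j < len g then μ g else 0) := by
    intro g
    have hnn : ∀ j ∈ Finset.range k, 0 ≤ (q : ℝ) ^ (j + 1) *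
        (if q ^ j < len g then μ g else 0) := fun j _ =>
      mul_nonneg (by positivity) ((good_ite hμ (fun g => q ^ j < len g)).nn g)
    by_cases h : len g ≤ q ^ k
    · have hν1 : ν g = μ g := by simp [hν, h]
      rw [hν1]
      by_cases h1 : len g ≤ 1
      · have : (len g : ℝ) ≤ 1 := by exact_mod_cast h1
        have := mul_le_mul_of_nonneg_right this (hμ.nn g)
        have := Finset.sum_nonneg hnn
        linarith
      · push Not at h1
        have hc : 0 < Nat.clog q (len g) := Nat.clog_pos (by omega) h1
        obtain ⟨j, hj⟩ : ∃ j, Nat.clog q (len g) = j + 1 := ⟨_, (Nat.succ_pred_eq_of_pos hc).symm⟩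
        have a1 : q ^ j < len g := by
          have := Nat.pow_pred_clog_lt_self (b := q) (by omega) h1
          rw [hj] at this; exact this
        have a2 : len g ≤ q ^ (j + 1) := by
          have := Nat.le_pow_clog (b := q) (by omega) (len g)
          rwa [hj] at this
        have a3 : j < k := by
          have : q ^ j < q ^ k := lt_of_lt_of_le a1 h
          exact (Nat.pow_lt_pow_iff_right (by omega)).mp this
        have := Finset.single_le_sum hnn (Finset.mem_range.mpr a3)
        rw [if_pos a1] at this
        have a4 : (len g : ℝ) ≤ (q : ℝ) ^ (j + 1) := by exact_mod_cast a2
        have := mul_le_mul_of_nonneg_right a4 (hμ.nn g)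
        have := hμ.nn g
        linarith
    · have : ν g = 0 := by simp [hν, h]
      rw [this, mul_zero]
      exact add_nonneg (hμ.nn g) (Finset.sum_nonneg hnn)
  have srhs : Summable (fun g => ∑ j ∈ Finset.range k,
      (q : ℝ) ^ (j + 1) * (if q ^ j < len g then μ g else 0)) :=
    summable_sum (fun j _ => (good_ite hμ _).sm.mul_left _)
  have hnn1 : ∀ g, 0 ≤ (len g : ℝ) * ν g := fun g => mul_nonneg (Nat.cast_nonneg _) (gν.nn g)
  have s1 : Summable (fun g => (len g : ℝ) * ν g) :=
    Summable.of_nonneg_of_le hnn1 hpt (hμ.sm.add srhs)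
  set E0 := C2 * ((q : ℝ) ^ k * I k) with hE0
  have hE0p : 0 < E0 := by have := hI k; positivity
  have hE : ∑' g, (len g : ℝ) * ν g ≤ E0 := by
    refine le_trans (Summable.tsum_le_tsum hpt s1 (hμ.sm.add srhs)) ?_
    rw [hμ.sm.tsum_add srhs, hμ1, Summable.tsum_finsetSum
      (fun j _ => (good_ite hμ _).sm.mul_left _)]
    refine le_trans ?_ (hkar k hkj)
    gcongr with j hj
    rw [tsum_mul_left]
    gcongr
    exact htail j
  obtain ⟨m1, m2⟩ := convPow_moment len hl1 hlm gν s1 n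
  rw [← hp] at m2
  have hp0 : 0 < p := by linarith
  have gνn := convPow_good gν n
  have m3 : ∑' g, (len g : ℝ) * convPow ν n g ≤ 2 * n * E0 * p ^ n := by
    have h0 : 0 ≤ ∑' g, (len g : ℝ) * convPow ν n g :=
      tsum_nonneg (fun g => mul_nonneg (Nat.cast_nonneg _) (gνn.nn g))
    have h1 : (n : ℝ) * (∑' g, (len g : ℝ) * ν g) * p ^ n ≤ n * E0 * p ^ n := by gcongr
    nlinarith
  set R : ℕ := ⌈4 * n * E0⌉₊ + 1 with hR
  have hR1 : 4 * n * E0 ≤ R := by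
    rw [hR]; push_cast
    have := Nat.le_ceil (4 * n * E0); linarith
  have hR2 : (R : ℝ) ≤ 4 * n * E0 + 2 := by
    rw [hR]; push_cast
    have := Nat.ceil_lt_add_one (show 0 ≤ 4 * n * E0 by positivity); linarith
  have hRpos : (0 : ℝ) < R := by rw [hR]; positivity
  obtain ⟨Bs, hBs1, hBs2⟩ := hV R (by omega)
  have hmass : p ^ n / 2 ≤ ∑ g ∈ Bs, convPow ν n g := by
    have hpt2 : ∀ g, convPow ν n g ≤ (if g ∈ Bs then convPow ν n g else 0)
        + (R : ℝ)⁻¹ * ((len g : ℝ) * convPow ν n g) := by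
      intro g
      have h0 := gνn.nn g
      split_ifs with hg
      · have : 0 ≤ (R : ℝ)⁻¹ * ((len g : ℝ) * convPow ν n g) := by positivity
        linarith
      · have : (R : ℝ) ≤ len g := by
          rw [hBs1] at hg; push Not at hg; exact_mod_cast hg.le
        rw [zero_add, ← mul_assoc]
        have h1 : 1 ≤ (R : ℝ)⁻¹ * len g := by
          rw [inv_mul_eq_div, le_div_iff₀ hRpos]; linarith
        nlinarith
    have ss := (good_ite gνn (fun g => g ∈ Bs)).sm
    have := Summable.tsum_le_tsum hpt2 gνn.sm (ss.add (m1.mul_left _))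
    rw [ss.tsum_add (m1.mul_left _), tsum_mul_left, tsum_convPow gν n, ← hp] at this
    have e1 : ∑' g, (if g ∈ Bs then convPow ν n g else 0) = ∑ g ∈ Bs, convPow ν n g := by
      rw [tsum_eq_sum (s := Bs) (fun b hb => by simp [hb])]
      exact Finset.sum_congr rfl (fun x hx => by simp [hx])
    rw [e1] at this
    have h2 : (R : ℝ)⁻¹ * ∑' g, (len g : ℝ) * convPow ν n g ≤ p ^ n / 2 := by
      rw [inv_mul_eq_div, div_le_iff₀ hRpos]
      have : p ^ n / 2 * (4 * n * E0) ≤ p ^ n / 2 * R := by gcongr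
      linarith
    linarith
  have hmass2 : p ^ n / 2 ≤ ∑ g ∈ Bs, convPow μ n g :=
    hmass.trans (Finset.sum_le_sum (fun g _ => convPow_mono hμ gν.nn νle n g))
  have hret := return_lower hμ hμs n Bs (p ^ n / 2) (by positivity) hmass2
  have hret0 : 0 ≤ convPow μ (2 * n) 1 := (convPow_good hμ _).nn 1
  -- volume
  have hqk : (1 : ℝ) ≤ (q : ℝ) ^ k := one_le_pow₀ (by linarith)
  have hRexp : (R : ℝ) ≤ 2 * (q : ℝ) ^ k * Real.exp (2 * C2 * (n * I k)) := by
    have h1 := Real.add_one_le_exp (2 * C2 * (n * I k))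
    calc (R : ℝ) ≤ 4 * n * E0 + 2 := hR2
      _ ≤ 4 * n * E0 + 2 * (q : ℝ) ^ k := by linarith
      _ = 2 * (q : ℝ) ^ k * (2 * C2 * (n * I k) + 1) := by rw [hE0]; ring
      _ ≤ _ := by gcongr
  have hRD : (R : ℝ) ^ D ≤ 2 ^ D * (q : ℝ) ^ (k * D) * Real.exp (2 * C2 * D * (n * I k)) := by
    calc (R : ℝ) ^ D ≤ (2 * (q : ℝ) ^ k * Real.exp (2 * C2 * (n * I k))) ^ D := by gcongr
      _ = _ := by
        rw [mul_pow, mul_pow, ← pow_mul, ← Real.exp_nat_mul]; congr 2; ring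
  have hpn : Real.exp (-(4 * B * (n * I k))) ≤ (p ^ n) ^ 2 := by
    calc Real.exp (-(4 * B * (n * I k))) = (Real.exp (-(2 * (B * I k)))) ^ (n * 2) := by
          rw [← Real.exp_nat_mul]; push_cast; congr 1; ring
      _ ≤ p ^ (n * 2) := by gcongr
      _ = _ := by rw [pow_mul]
  have key : Real.exp (-(4 * B * (n * I k))) / 4 ≤
      CV * (2 ^ D * (q : ℝ) ^ (k * D) * Real.exp (2 * C2 * D * (n * I k))) *
        convPow μ (2 * n) 1 := by
    calc _ ≤ (p ^ n) ^ 2 / 4 := by gcongr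
      _ = (p ^ n / 2) ^ 2 := by ring
      _ ≤ Bs.card * convPow μ (2 * n) 1 := hret
      _ ≤ CV * (R : ℝ) ^ D * convPow μ (2 * n) 1 := by gcongr
      _ ≤ _ := by gcongr
  have hqkD : (0:ℝ) < (q : ℝ) ^ (k * D) := by positivity
  have hee : Real.exp (-((4 * B + 2 * C2 * D) * (n * I k))) =
      Real.exp (-(4 * B * (n * I k))) / Real.exp (2 * C2 * D * (n * I k)) := by
    rw [← Real.exp_sub]; congr 1; ring
  rw [hee]
  have hex := Real.exp_pos (2 * C2 * D * (n * I k))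
  have : 1 / (4 * CV * 2 ^ D) * (((q : ℝ) ^ (k * D))⁻¹ * (Real.exp (-(4 * B * (n * I k))) /
      Real.exp (2 * C2 * D * (n * I k)))) = (Real.exp (-(4 * B * (n * I k))) / 4) /
      (CV * (2 ^ D * (q : ℝ) ^ (k * D) * Real.exp (2 * C2 * D * (n * I k)))) := by
    field_simp
  rw [this, div_le_iff₀ (by positivity)]
  linarith
/-! ### Upper bound -/

lemma upper_bound {G : Type*} [Group G] (len : G → ℕ) (D : ℕ) (hD : 1 ≤ D)
    (q : ℕ) (hq : 4 ≤ q) (I a : ℕ → ℝ)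
    (ha : ∀ j, 0 < a j) (hanti : Antitone a) (ha0 : Tendsto a atTop (𝓝 0))
    (c3 c4 : ℝ) (hc3 : 0 < c3) (hc4 : 0 < c4)
    (hI3 : ∀ j, c3 * a j ≤ I j - I (j + 1)) (hI4 : ∀ j, I j - I (j + 1) ≤ c4 * a j)
    (hI : ∀ j, 0 < I j)
    (η : G → ℝ) (hη : Good η) (hη1 : ∑' g, η g = 1)
    (c2 H0 : ℝ) (hc2 : 0 < c2) (hH0 : 0 < H0)
    (hT : ∀ k, c2 * I k ≤ ∑' g, (if q ^ k < len g then η g else 0))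
    (hshell : ∀ k g, q ^ k < len g → η g ≤ H0 * ((q : ℝ) ^ (k * D))⁻¹ *
      (∑' g, (if len g ≤ q ^ (k + 1) then η g else 0) -
        ∑' g, (if len g ≤ q ^ k then η g else 0)))
    (C1 : ℝ) (hC1 : 0 < C1) (k0 : ℕ) :
    ∃ (N : ℕ) (C' : ℝ), 0 < N ∧ 0 < C' ∧ ∀ n : ℕ, 1 ≤ n → ∃ k, k0 ≤ k ∧
      ∀ m, 2 * N * n ≤ m → ∀ g,
        convPow η m g ≤ C' * (((q : ℝ) ^ (k * D))⁻¹ * Real.exp (-(C1 * (n * I k)))) := by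
  have hq0 : (4 : ℝ) ≤ q := by exact_mod_cast hq
  have hqD : (4 : ℝ) ≤ (q : ℝ) ^ D := by
    calc (4 : ℝ) ≤ q := hq0
      _ = (q : ℝ) ^ 1 := (pow_one _).symm
      _ ≤ _ := pow_le_pow_right₀ (by linarith) hD
  have hqk : ∀ k : ℕ, (0 : ℝ) < (q : ℝ) ^ (k * D) := fun k => by positivity
  have hqs : ∀ k : ℕ, (q : ℝ) ^ ((k + 1) * D) = (q : ℝ) ^ (k * D) * (q : ℝ) ^ D := fun k => by
    rw [← pow_add]; congr 1; ring
  have hl2 : 0 < Real.log 2 := Real.log_pos (by norm_num)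
  set δ : ℝ := min (a k0) (Real.log 2 / (C1 * c4)) with hδ
  have hδ0 : 0 < δ := lt_min (ha k0) (by positivity)
  have hδ1 : δ ≤ a k0 := min_le_left _ _
  have hδ2 : C1 * c4 * δ ≤ Real.log 2 := by
    have : δ ≤ Real.log 2 / (C1 * c4) := min_le_right _ _
    rw [le_div_iff₀ (by positivity)] at this
    linarith
  set γ : ℝ := max C1 ((Real.log ((q : ℝ) ^ D) + Real.log 2) / (c3 * δ)) with hγ
  have hγ1 : C1 ≤ γ := le_max_left _ _
  have hγ0 : 0 < γ := lt_of_lt_of_le hC1 hγ1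
  have hγ2 : Real.log ((q : ℝ) ^ D) + Real.log 2 ≤ γ * (c3 * δ) := by
    have : (Real.log ((q : ℝ) ^ D) + Real.log 2) / (c3 * δ) ≤ γ := le_max_right _ _
    rwa [div_le_iff₀ (by positivity)] at this
  obtain ⟨N, hN⟩ := exists_nat_gt (γ / (2 * c2))
  have hN0 : 0 < N := by
    have : (0 : ℝ) < N := lt_trans (by positivity) hN
    exact_mod_cast this
  rw [div_lt_iff₀ (by positivity)] at hN
  set Bc : ℝ := max 1 (2 * (H0 * (q : ℝ) ^ D)) with hBc
  have hB1 : 1 ≤ Bc := le_max_left _ _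
  have hB2 : 2 * (H0 * (q : ℝ) ^ D) ≤ Bc := le_max_right _ _
  refine ⟨N, Bc + 2 * (H0 * (q : ℝ) ^ D) + 1, hN0, by positivity, ?_⟩
  intro n hn
  have hn0 : (1 : ℝ) ≤ n := by exact_mod_cast hn
  have hex : ∃ k, a k < δ / n := by
    have := ha0.eventually_lt_const (show 0 < δ / n by positivity)
    exact this.exists
  set ks := Nat.find hex with hks
  have hks1 : a ks < δ / n := Nat.find_spec hex
  have hks2 : ∀ j, j < ks → δ / n ≤ a j := fun j hj => not_lt.mp (Nat.find_min hex hj)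
  have hks0 : k0 ≤ ks := by
    by_contra hlt
    push Not at hlt
    have h1 := hanti hlt.le
    have h2 : δ / n ≤ δ := div_le_self hδ0.le hn0
    linarith
  refine ⟨ks, hks0, ?_⟩
  intro m hm
  set f : ℕ → G → ℝ := fun k g => if len g ≤ q ^ k then η g else 0 with hf
  have gf : ∀ k, Good (f k) := fun k => good_ite hη (fun g => len g ≤ q ^ k)
  have hsplit : ∀ k, ∑' g, f k g + ∑' g, (if q ^ k < len g then η g else 0) = 1 := by
    intro k
    rw [← (gf k).sm.tsum_add (good_ite hη _).sm, ← hη1]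
    congr 1; ext g
    simp only [hf]
    by_cases h : len g ≤ q ^ k
    · simp [h, not_lt.mpr h]
    · simp [h, not_le.mp h]
  set p : ℕ → ℝ := fun k => ∑' g, f k g with hp
  have hp1 : ∀ k, p k ≤ 1 - c2 * I k := fun k => by
    have := hsplit k; have := hT k; simp only [hp]; linarith
  have hp0 : ∀ k, 0 ≤ p k := fun k => (gf k).tsum_nn
  have hpm : ∀ k, p k ^ m ≤ Real.exp (-(γ * (n * I k))) := by
    intro k
    have h1 : p k ≤ Real.exp (-(c2 * I k)) := by
      have := Real.add_one_le_exp (-(c2 * I k)); have := hp1 k; linarith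
    calc p k ^ m ≤ Real.exp (-(c2 * I k)) ^ m := pow_le_pow_left₀ (hp0 k) h1 m
      _ = Real.exp (-(m * (c2 * I k))) := by rw [← Real.exp_nat_mul]; congr 1; ring
      _ ≤ _ := by
        rw [Real.exp_le_exp, neg_le_neg_iff]
        have h2 : (2 * N * n : ℝ) ≤ m := by exact_mod_cast hm
        have h3 := hI k
        calc γ * (n * I k) ≤ (N * (2 * c2)) * (n * I k) := by gcongr
          _ = (2 * N * n) * (c2 * I k) := by ring
          _ ≤ _ := by gcongr
  have hfle : ∀ k g, f k g ≤ f (k + 1) g := by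
    intro k g
    simp only [hf]
    by_cases h : len g ≤ q ^ k
    · have : len g ≤ q ^ (k + 1) := h.trans (Nat.pow_le_pow_right (by omega) (by omega))
      simp [h, this]
    · simp only [h, if_false]; exact (gf (k+1)).nn g
  have hfη : ∀ k g, f k g ≤ η g := by
    intro k g
    simp only [hf]
    split_ifs
    · exact le_rfl
    · exact hη.nn g
  have hpmono : ∀ k, p k ≤ p (k + 1) := fun k =>
    Summable.tsum_le_tsum (hfle k) (gf k).sm (gf (k + 1)).sm
  have hpη : ∀ k, p k ≤ 1 := fun k => by
    rw [← hη1]; exact Summable.tsum_le_tsum (hfη k) (gf k).sm hη.sm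
  have hshell' : ∀ k g, q ^ k < len g → η g ≤ H0 * ((q : ℝ) ^ (k * D))⁻¹ * (p (k + 1) - p k) :=
    hshell
  have hHk : ∀ k : ℕ, 0 ≤ H0 * ((q : ℝ) ^ (k * D))⁻¹ := fun k => by positivity
  have hstep : ∀ k g, convPow (f (k + 1)) m g ≤ convPow (f k) m g
      + H0 * ((q : ℝ) ^ (k * D))⁻¹ * p (k + 1) ^ m := by
    intro k g
    refine convPow_diff (gf k) (gf (k + 1)) (hfle k) _ (hHk k) ?_ m g
    intro g
    by_cases h : len g ≤ q ^ k
    · have : f (k + 1) g - f k g = 0 := by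
        have : len g ≤ q ^ (k + 1) := h.trans (Nat.pow_le_pow_right (by omega) (by omega))
        simp [hf, h, this]
      rw [this]
      exact mul_nonneg (hHk k) (sub_nonneg.mpr (hpmono k))
    · have e : f k g = 0 := by simp [hf, h]
      rw [e, sub_zero]
      exact (hfη (k + 1) g).trans (hshell' k g (not_le.mp h))
  have hlast : ∀ k g, convPow η m g ≤ convPow (f k) m g + H0 * ((q : ℝ) ^ (k * D))⁻¹ := by
    intro k g
    have := convPow_diff (gf k) hη (hfη k) _ (hHk k) ?_ m g
    · rwa [hη1, one_pow, mul_one] at this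
    · intro g
      rw [hη1]
      have hpk := hpη k
      by_cases h : len g ≤ q ^ k
      · have : η g - f k g = 0 := by simp [hf, h]
        rw [this]
        exact mul_nonneg (hHk k) (sub_nonneg.mpr hpk)
      · have e : f k g = 0 := by simp [hf, h]
        rw [e, sub_zero]
        refine (hshell' k g (not_le.mp h)).trans (mul_le_mul_of_nonneg_left ?_ (hHk k))
        have := hpη (k + 1)
        change p (k + 1) - p k ≤ 1 - p k
        linarith
  set Q : ℕ → ℝ := fun k => ((q : ℝ) ^ (k * D))⁻¹ * Real.exp (-(γ * (n * I k))) with hQ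
  set R : ℕ → ℝ := fun k => ((q : ℝ) ^ (k * D))⁻¹ * Real.exp (-(C1 * (n * I k))) with hR
  have hQpos : ∀ k, 0 < Q k := fun k => mul_pos (inv_pos.mpr (hqk k)) (Real.exp_pos _)
  have hRpos : ∀ k, 0 < R k := fun k => mul_pos (inv_pos.mpr (hqk k)) (Real.exp_pos _)
  have hQR : ∀ k, Q k ≤ R k := by
    intro k
    refine mul_le_mul_of_nonneg_left ?_ (inv_pos.mpr (hqk k)).le
    rw [Real.exp_le_exp, neg_le_neg_iff]
    have := hI k
    gcongr
  have hinc : ∀ k, H0 * ((q : ℝ) ^ (k * D))⁻¹ * p (k + 1) ^ m ≤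
      H0 * (q : ℝ) ^ D * Q (k + 1) := by
    intro k
    calc _ ≤ H0 * ((q : ℝ) ^ (k * D))⁻¹ * Real.exp (-(γ * (n * I (k + 1)))) :=
          mul_le_mul_of_nonneg_left (hpm (k + 1)) (hHk k)
      _ = _ := by
        simp only [hQ, hqs k]
        have := hqk k
        field_simp
  have hQhalf : ∀ k, k < ks → 2 * Q k ≤ Q (k + 1) := by
    intro k hk
    have h1 := hks2 k hk
    have h2 := hI3 k
    have h3 : Real.log ((q : ℝ) ^ D) + Real.log 2 + -(γ * (n * I k)) ≤
        -(γ * (n * I (k + 1))) := by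
      have h4 : c3 * (δ / n) ≤ I k - I (k + 1) := le_trans (by gcongr) h2
      have h5 : n * (c3 * (δ / n)) ≤ n * (I k - I (k + 1)) := by gcongr
      have h6 : n * (c3 * (δ / n)) = c3 * δ := by field_simp
      have h7 : γ * (c3 * δ) ≤ γ * (n * (I k - I (k + 1))) := by rw [← h6]; gcongr
      have h8 : γ * (n * (I k - I (k + 1))) = γ * (n * I k) - γ * (n * I (k + 1)) := by ring
      linarith
    have h4 := Real.exp_le_exp.mpr h3
    rw [Real.exp_add, Real.exp_add, Real.exp_log (by positivity), Real.exp_log (by norm_num)] at h4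
    simp only [hQ, hqs k]
    have hk0 := hqk k
    rw [mul_inv]
    calc _ = (((q : ℝ) ^ (k * D))⁻¹ * ((q : ℝ) ^ D)⁻¹) *
          ((q : ℝ) ^ D * 2 * Real.exp (-(γ * (n * I k)))) := by field_simp
      _ ≤ _ := by gcongr
  have hRhalf : ∀ k, ks ≤ k → 2 * R (k + 1) ≤ R k := by
    intro k hk
    have h1 : a k ≤ δ / n := (hanti hk).trans hks1.le
    have h2 := hI4 k
    have h3 : -(C1 * (n * I (k + 1))) ≤ Real.log 2 + -(C1 * (n * I k)) := by
      have h4 : I k - I (k + 1) ≤ c4 * (δ / n) := h2.trans (by gcongr)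
      have h5 : n * (I k - I (k + 1)) ≤ n * (c4 * (δ / n)) := by gcongr
      have h6 : n * (c4 * (δ / n)) = c4 * δ := by field_simp
      have h7 : C1 * (n * (I k - I (k + 1))) ≤ C1 * (c4 * δ) := by rw [← h6]; gcongr
      have h8 : C1 * (n * (I k - I (k + 1))) = C1 * (n * I k) - C1 * (n * I (k + 1)) := by ring
      linarith
    have h4 := Real.exp_le_exp.mpr h3
    rw [Real.exp_add, Real.exp_log (by norm_num)] at h4
    simp only [hR, hqs k]
    rw [mul_inv]
    have hk0 := hqk k
    have h5 : ((q : ℝ) ^ D)⁻¹ ≤ 4⁻¹ := inv_anti₀ (by norm_num) hqD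
    calc _ ≤ 2 * ((((q : ℝ) ^ (k * D))⁻¹ * 4⁻¹) * (2 * Real.exp (-(C1 * (n * I k))))) := by
          gcongr
      _ = _ := by ring
  have hA : ∀ k, k ≤ ks → ∀ g, convPow (f k) m g ≤ Bc * Q k := by
    intro k
    induction k with
    | zero =>
      intro _ g
      have h1 : convPow (f 0) m g ≤ p 0 ^ m := by
        have := (convPow_good (gf 0) m).le_tsum g
        rwa [tsum_convPow (gf 0) m] at this
      have h2 : Q 0 = Real.exp (-(γ * (n * I 0))) := by simp [hQ]
      have h3 := hpm 0
      rw [← h2] at h3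
      have := hQpos 0
      nlinarith
    | succ k ih =>
      intro hk g
      have h1 := ih (by omega) g
      have h2 := hstep k g
      have h3 := hinc k
      have h4 := hQhalf k (by omega)
      have h5 := hQpos (k + 1)
      have h6 : Bc * (2 * Q k) ≤ Bc * Q (k + 1) := by gcongr
      have h7 : 2 * (H0 * (q : ℝ) ^ D) * Q (k + 1) ≤ Bc * Q (k + 1) := by gcongr
      linarith
  have hBd : ∀ k, ks ≤ k → ∀ g, convPow (f k) m g ≤
      Bc * R ks + 2 * (H0 * (q : ℝ) ^ D) * (R ks - R k) := by
    intro k hk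
    induction k, hk using Nat.le_induction with
    | base =>
      intro g
      have h1 := hA ks le_rfl g
      have h2 : Bc * Q ks ≤ Bc * R ks := by gcongr; exact hQR ks
      linarith
    | succ k hk ih =>
      intro g
      have h1 := ih g
      have h2 := hstep k g
      have h3 := hinc k
      have h4 := hRhalf k hk
      have h5 := hQR (k + 1)
      have h6 : H0 * (q : ℝ) ^ D * Q (k + 1) ≤ H0 * (q : ℝ) ^ D * R (k + 1) := by gcongr
      have h7 : H0 * (q : ℝ) ^ D * (2 * R (k + 1)) ≤ H0 * (q : ℝ) ^ D * R k := by gcongr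
      have h8 : 0 < H0 * (q : ℝ) ^ D * R (k + 1) := by have := hRpos (k + 1); positivity
      linarith
  intro g
  obtain ⟨K, hK⟩ := exists_pow_lt_of_lt_one (show 0 < R ks / H0 from div_pos (hRpos ks) hH0)
    (show ((q : ℝ) ^ D)⁻¹ < 1 from inv_lt_one_of_one_lt₀ (by linarith))
  have hKs : H0 * ((q : ℝ) ^ ((ks + K) * D))⁻¹ ≤ R ks := by
    have h1 : ((q : ℝ) ^ ((ks + K) * D))⁻¹ ≤ (((q : ℝ) ^ D)⁻¹) ^ K := by
      rw [inv_pow]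
      refine inv_anti₀ (by positivity) ?_
      rw [← pow_mul]
      exact pow_le_pow_right₀ (by linarith) (by nlinarith)
    rw [lt_div_iff₀ hH0] at hK
    have := mul_le_mul_of_nonneg_left h1 hH0.le
    linarith
  have h1 := hlast (ks + K) g
  have h2 := hBd (ks + K) (by omega) g
  have h3 : 0 < 2 * (H0 * (q : ℝ) ^ D) * R (ks + K) := by have := hRpos (ks + K); positivity
  change _ ≤ _ * R ks
  linarith
/-! ### Analysis of the integral -/

def tailInt (l : ℝ → ℝ) (s : ℝ) : ℝ := ∫ t in Set.Ioc (0:ℝ) (1/s), 1 / (t * l (1/t))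

lemma thetaOf_eq (l : ℝ → ℝ) (s : ℝ) : thetaOf l s = 1 / tailInt l s := rfl

lemma thetaOf_zero (l : ℝ → ℝ) : thetaOf l 0 = 0 := by simp [thetaOf]

section analysis
variable {l : ℝ → ℝ}

lemma int_ok (hlint : IntegrableOn (fun t => 1 / (t * l t)) (Set.Ioi 1)) :
    IntegrableOn (fun t => 1 / (t * l (1/t))) (Set.Ioc 0 1) := by
  rw [integrableOn_Ioc_iff_integrableOn_Ioo]
  have himg : (fun t : ℝ => t⁻¹) '' Set.Ioo 0 1 = Set.Ioi 1 := by
    ext y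
    simp only [Set.mem_image, Set.mem_Ioo, Set.mem_Ioi]
    constructor
    · rintro ⟨x, ⟨h0, h1⟩, rfl⟩
      exact (one_lt_inv₀ h0).mpr h1
    · intro hy
      exact ⟨y⁻¹, ⟨by positivity, inv_lt_one_of_one_lt₀ hy⟩, inv_inv y⟩
  have := (integrableOn_image_iff_integrableOn_abs_deriv_smul (f := fun t : ℝ => t⁻¹)
    (f' := fun t => -(t ^ 2)⁻¹) (s := Set.Ioo (0:ℝ) 1) measurableSet_Ioo
    (fun x hx => (hasDerivAt_inv hx.1.ne').hasDerivWithinAt)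
    (fun x _ y _ h => inv_injective h) (fun t => 1 / (t * l t)))
  rw [himg] at this
  refine (integrableOn_congr_fun ?_ measurableSet_Ioo).mp (this.mp hlint)
  intro t ht
  have h0 : 0 < t := ht.1
  simp only [smul_eq_mul, abs_neg, one_div]
  rw [abs_of_pos (by positivity), mul_inv, mul_inv]
  field_simp

lemma int_ok' (hlint : IntegrableOn (fun t => 1 / (t * l t)) (Set.Ioi 1)) {s : ℝ} (hs : 1 ≤ s) :
    IntegrableOn (fun t => 1 / (t * l (1/t))) (Set.Ioc 0 (1/s)) := by
  refine (int_ok hlint).mono_set (Set.Ioc_subset_Ioc_right ?_)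
  rw [div_le_one (by linarith)]; exact hs

lemma tailInt_nn (hlpos : ∀ x, 0 ≤ x → 0 < l x) (s : ℝ) : 0 ≤ tailInt l s := by
  refine setIntegral_nonneg measurableSet_Ioc (fun t ht => ?_)
  have h0 : 0 < t := ht.1
  have := hlpos (1/t) (by positivity)
  positivity

lemma tailInt_sub (hlint : IntegrableOn (fun t => 1 / (t * l t)) (Set.Ioi 1)) {s s' : ℝ}
    (hs : 1 ≤ s) (hss : s ≤ s') :
    tailInt l s - tailInt l s' = ∫ t in Set.Ioc (1/s') (1/s), 1 / (t * l (1/t)) := by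
  have h1 : 1 / s' ≤ 1 / s := by
    apply one_div_le_one_div_of_le <;> linarith
  have h0 : 0 ≤ 1 / s' := by apply one_div_nonneg.mpr; linarith
  have hu : Set.Ioc 0 (1/s) = Set.Ioc 0 (1/s') ∪ Set.Ioc (1/s') (1/s) :=
    (Set.Ioc_union_Ioc_eq_Ioc h0 h1).symm
  unfold tailInt
  rw [hu, setIntegral_union]
  · ring
  · rw [Set.disjoint_left]
    intro x hx hx'
    exact absurd hx.2 (not_le.mpr hx'.1)
  · exact measurableSet_Ioc
  · exact int_ok' hlint (hs.trans hss)
  · exact (int_ok' hlint hs).mono_set (Set.Ioc_subset_Ioc_left h0)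

lemma tailInt_anti (hlpos : ∀ x, 0 ≤ x → 0 < l x)
    (hlint : IntegrableOn (fun t => 1 / (t * l t)) (Set.Ioi 1)) {s s' : ℝ}
    (hs : 1 ≤ s) (hss : s ≤ s') : tailInt l s' ≤ tailInt l s := by
  have := tailInt_sub hlint hs hss
  have h2 : 0 ≤ ∫ t in Set.Ioc (1/s') (1/s), 1 / (t * l (1/t)) := by
    refine setIntegral_nonneg measurableSet_Ioc (fun t ht => ?_)
    have h0 : 0 < t := lt_of_le_of_lt (one_div_nonneg.mpr (by linarith)) ht.1
    have := hlpos (1/t) (by positivity)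
    positivity
  linarith

lemma tailInt_step (hlpos : ∀ x, 0 ≤ x → 0 < l x) (hlmono : MonotoneOn l (Set.Ici 0))
    (hlint : IntegrableOn (fun t => 1 / (t * l t)) (Set.Ioi 1)) {s L : ℝ}
    (hs : 1 ≤ s) (hL : 2 ≤ L) :
    1 / 2 * (1 / l (L * s)) ≤ tailInt l s - tailInt l (L * s) ∧
      tailInt l s - tailInt l (L * s) ≤ L * (1 / l s) := by
  have hs0 : 0 < s := by linarith
  have hLs : s ≤ L * s := by nlinarith
  have hLs0 : 0 < L * s := by positivity
  rw [tailInt_sub hlint hs hLs]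
  have hle : 1 / (L * s) ≤ 1 / s := one_div_le_one_div_of_le hs0 hLs
  have hint : IntegrableOn (fun t => 1 / (t * l (1/t))) (Set.Ioc (1/(L*s)) (1/s)) :=
    (int_ok' hlint hs).mono_set (Set.Ioc_subset_Ioc_left (by positivity))
  have hvol : (volume.real (Set.Ioc (1/(L*s)) (1/s))) = 1/s - 1/(L*s) := by
    rw [Real.volume_real_Ioc_of_le hle]
  have hl1 := hlpos s hs0.le
  have hl2 := hlpos (L * s) hLs0.le
  constructor
  · have : ∫ t in Set.Ioc (1/(L*s)) (1/s), s * (1 / l (L * s)) ≤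
        ∫ t in Set.Ioc (1/(L*s)) (1/s), 1 / (t * l (1/t)) := by
      refine setIntegral_mono_on (integrableOn_const (by simp)) hint measurableSet_Ioc ?_
      intro t ht
      have h0 : 0 < t := lt_of_le_of_lt (by positivity) ht.1
      have h1 : 1 / t ≤ L * s := by
        rw [div_le_iff₀ h0]
        have := ht.1
        rw [div_lt_iff₀ hLs0] at this
        nlinarith
      have h2 : l (1/t) ≤ l (L * s) := hlmono (by simp; positivity) (by simp; positivity) h1
      have h3 := hlpos (1/t) (by positivity)
      have h4 : t * s ≤ 1 := by
        have := ht.2; rwa [le_div_iff₀ hs0] at this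
      rw [mul_one_div, div_le_div_iff₀ hl2 (by positivity)]
      calc s * (t * l (1/t)) = (t * s) * l (1/t) := by ring
        _ ≤ 1 * l (L * s) := by gcongr
    rw [setIntegral_const, hvol, smul_eq_mul] at this
    refine le_trans ?_ this
    have e : (1/s - 1/(L*s)) * (s * (1 / l (L * s))) = (1 - 1 / L) * (1 / l (L * s)) := by
      field_simp
    rw [e]
    gcongr
    have : 1 / L ≤ 1 / 2 := one_div_le_one_div_of_le (by norm_num) hL
    linarith
  · have : ∫ t in Set.Ioc (1/(L*s)) (1/s), 1 / (t * l (1/t)) ≤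
        ∫ t in Set.Ioc (1/(L*s)) (1/s), (L * s) * (1 / l s) := by
      refine setIntegral_mono_on hint (integrableOn_const (by simp)) measurableSet_Ioc ?_
      intro t ht
      have h0 : 0 < t := lt_of_le_of_lt (by positivity) ht.1
      have h1 : s ≤ 1 / t := by
        rw [le_div_iff₀ h0]
        have := ht.2; rw [le_div_iff₀ hs0] at this; linarith
      have h2 : l s ≤ l (1/t) := hlmono (by simp; positivity) (by simp; positivity) h1
      have h3 := hlpos (1/t) (by positivity)
      have h4 : 1 ≤ t * (L * s) := by
        have := ht.1; rw [div_lt_iff₀ hLs0] at this; exact this.le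
      rw [mul_one_div, div_le_div_iff₀ (by positivity) hl1]
      calc 1 * l s ≤ (t * (L * s)) * l (1/t) := by gcongr
        _ = _ := by ring
    rw [setIntegral_const, hvol, smul_eq_mul] at this
    refine le_trans this ?_
    have e : (1/s - 1/(L*s)) * ((L * s) * (1 / l s)) = (L - 1) * (1 / l s) := by
      field_simp
    rw [e]
    gcongr
    linarith

lemma tailInt_pos (hlpos : ∀ x, 0 ≤ x → 0 < l x) (hlmono : MonotoneOn l (Set.Ici 0))
    (hlint : IntegrableOn (fun t => 1 / (t * l t)) (Set.Ioi 1)) {s : ℝ}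
    (hs : 1 ≤ s) : 0 < tailInt l s := by
  have h1 := (tailInt_step hlpos hlmono hlint hs (le_refl 2)).1
  have h2 := tailInt_nn hlpos (2 * s)
  have h3 := hlpos (2 * s) (by linarith)
  have : 0 < 1 / 2 * (1 / l (2 * s)) := by positivity
  linarith

lemma tailInt_tendsto (hlint : IntegrableOn (fun t => 1 / (t * l t)) (Set.Ioi 1))
    (u : ℕ → ℝ) (hu : Monotone u) (hu1 : ∀ n, 1 ≤ u n) (hut : Tendsto u atTop atTop) :
    Tendsto (fun n => tailInt l (u n)) atTop (𝓝 0) := by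
  have := tendsto_setIntegral_of_antitone (μ := volume) (f := fun t => 1 / (t * l (1/t)))
    (s := fun n => Set.Ioc (0:ℝ) (1 / u n)) (fun n => measurableSet_Ioc) ?_
    ⟨0, int_ok' hlint (hu1 0)⟩
  · have he : ⋂ n, Set.Ioc (0:ℝ) (1 / u n) = ∅ := by
      rw [Set.eq_empty_iff_forall_notMem]
      intro x hx
      simp only [Set.mem_iInter, Set.mem_Ioc] at hx
      have h0 := (hx 0).1
      obtain ⟨n, hn⟩ := (hut.eventually_gt_atTop (1 / x)).exists
      have h1 := (hx n).2
      have h2 : 0 < u n := by have := hu1 n; linarith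
      rw [le_div_iff₀ h2] at h1
      rw [div_lt_iff₀ h0] at hn
      linarith
    rw [he] at this
    simpa [tailInt] using this
  · intro m n hmn
    refine Set.Ioc_subset_Ioc_right ?_
    have := hu1 m
    exact one_div_le_one_div_of_le (by linarith) (hu hmn)

lemma l_doubling (hlpos : ∀ x, 0 ≤ x → 0 < l x) (hlmono : MonotoneOn l (Set.Ici 0))
    (hlsv : SlowlyVarying l) (lam : ℝ) (hlam : 0 < lam) :
    ∃ K : ℝ, 0 < K ∧ ∀ x, 0 ≤ x → l (lam * x) ≤ K * l x := by
  have h := (hlsv lam hlam).eventually_le_const (show (1:ℝ) < 2 by norm_num)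
  obtain ⟨x0, hx0⟩ := eventually_atTop.mp h
  set X := max x0 0 with hX
  have hX0 : 0 ≤ X := le_max_right _ _
  have p0 := hlpos 0 le_rfl
  refine ⟨max 2 (l (lam * X) / l 0), lt_max_of_lt_left (by norm_num), ?_⟩
  intro x hx
  have px := hlpos x hx
  by_cases hxx : X ≤ x
  · have := hx0 x ((le_max_left _ _).trans hxx)
    rw [div_le_iff₀ px] at this
    refine this.trans ?_
    gcongr
    exact le_max_left _ _
  · push Not at hxx
    have h1 : l (lam * x) ≤ l (lam * X) :=
      hlmono (by simp; positivity) (by simp; positivity) (by gcongr)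
    have h2 : l 0 ≤ l x := hlmono (by simp) (by simpa using hx) hx
    have pX := hlpos (lam * X) (by positivity)
    calc l (lam * x) ≤ l (lam * X) := h1
      _ = (l (lam * X) / l 0) * l 0 := by field_simp
      _ ≤ (l (lam * X) / l 0) * l x := by gcongr
      _ ≤ _ := by gcongr; exact le_max_right _ _

/-- All the sequence data extracted from `l`. -/
structure SeqData (l : ℝ → ℝ) (q : ℕ) (c3 c4 : ℝ) (j0 : ℕ) : Prop where
  hc3 : 0 < c3
  hc4 : 0 < c4
  Ipos : ∀ j : ℕ, 0 < tailInt l (((q : ℝ) ^ j) ^ 2)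
  Ilim : Tendsto (fun j : ℕ => tailInt l (((q : ℝ) ^ j) ^ 2)) atTop (𝓝 0)
  apos : ∀ j : ℕ, 0 < 1 / l (((q : ℝ) ^ j) ^ 2)
  aanti : Antitone (fun j : ℕ => 1 / l (((q : ℝ) ^ j) ^ 2))
  alim : Tendsto (fun j : ℕ => 1 / l (((q : ℝ) ^ j) ^ 2)) atTop (𝓝 0)
  lo : ∀ j : ℕ, c3 * (1 / l (((q : ℝ) ^ j) ^ 2)) ≤
    tailInt l (((q : ℝ) ^ j) ^ 2) - tailInt l (((q : ℝ) ^ (j + 1)) ^ 2)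
  hi : ∀ j : ℕ, tailInt l (((q : ℝ) ^ j) ^ 2) - tailInt l (((q : ℝ) ^ (j + 1)) ^ 2) ≤
    c4 * (1 / l (((q : ℝ) ^ j) ^ 2))
  db : ∀ j : ℕ, j0 ≤ j → tailInt l (((q : ℝ) ^ j) ^ 2) ≤ 2 * tailInt l (((q : ℝ) ^ (j + 1)) ^ 2)

lemma seqData (hlpos : ∀ x, 0 ≤ x → 0 < l x)
    (hlmono : MonotoneOn l (Set.Ici 0)) (hlsv : SlowlyVarying l)
    (hlint : IntegrableOn (fun t => 1 / (t * l t)) (Set.Ioi 1)) (q : ℕ) (hq : 4 ≤ q) :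
    ∃ c3 c4 j0, SeqData l q c3 c4 j0 := by
  have hq0 : (4 : ℝ) ≤ q := by exact_mod_cast hq
  set u : ℕ → ℝ := fun j => ((q : ℝ) ^ j) ^ 2 with hu
  have hus : ∀ j, u (j + 1) = (q : ℝ) ^ 2 * u j := fun j => by simp only [hu]; ring
  have hu1 : ∀ j, 1 ≤ u j := fun j => one_le_pow₀ (one_le_pow₀ (by linarith))
  have hL : (2 : ℝ) ≤ (q : ℝ) ^ 2 := by nlinarith
  have hum : Monotone u := monotone_nat_of_le_succ (fun j => by
    rw [hus]; have := hu1 j; nlinarith)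
  have hut : Tendsto u atTop atTop := by
    have : u = fun j => ((q : ℝ) ^ 2) ^ j := by
      ext j; simp only [hu]; rw [← pow_mul, ← pow_mul, mul_comm]
    rw [this]
    exact tendsto_pow_atTop_atTop_of_one_lt (by linarith)
  have hst := fun j => tailInt_step hlpos hlmono hlint (hu1 j) hL
  have apos : ∀ j, 0 < 1 / l (u j) := fun j =>
    one_div_pos.mpr (hlpos _ (by have := hu1 j; linarith))
  have aanti : Antitone (fun j : ℕ => 1 / l (u j)) := by
    intro i j hij
    refine one_div_le_one_div_of_le (hlpos _ (by have := hu1 i; linarith)) ?_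
    refine hlmono ?_ ?_ (hum hij)
    · have := hu1 i; simp only [Set.mem_Ici]; linarith
    · have := hu1 j; simp only [Set.mem_Ici]; linarith
  have Ilim := tailInt_tendsto hlint u hum hu1 hut
  have Ipos : ∀ j, 0 < tailInt l (u j) := fun j => tailInt_pos hlpos hlmono hlint (hu1 j)
  obtain ⟨K, hK, hKd⟩ := l_doubling hlpos hlmono hlsv ((q : ℝ) ^ 2) (by positivity)
  have lo : ∀ j, 1 / (2 * K) * (1 / l (u j)) ≤ tailInt l (u j) - tailInt l (u (j + 1)) := by
    intro j
    rw [hus]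
    refine le_trans ?_ (hst j).1
    have h0 : 0 ≤ u j := by have := hu1 j; linarith
    have h1 := hKd (u j) h0
    have p1 := hlpos _ h0
    have p2 := hlpos ((q:ℝ) ^ 2 * u j) (by positivity)
    rw [div_mul_div_comm, div_mul_div_comm, one_mul]
    apply one_div_le_one_div_of_le <;> nlinarith
  have lo2 : ∀ j, 1 / 2 * (1 / l (u (j + 1))) ≤ tailInt l (u j) - tailInt l (u (j + 1)) := by
    intro j; rw [hus]; exact (hst j).1
  have hi : ∀ j, tailInt l (u j) - tailInt l (u (j + 1)) ≤ (q : ℝ) ^ 2 * (1 / l (u j)) := by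
    intro j; rw [hus]; exact (hst j).2
  have alim : Tendsto (fun j : ℕ => 1 / l (u j)) atTop (𝓝 0) := by
    have h2 : Tendsto (fun j => (2 * K) * tailInt l (u j)) atTop (𝓝 0) := by
      simpa using Ilim.const_mul (2 * K)
    refine squeeze_zero (fun j => (apos j).le) (fun j => ?_) h2
    have := lo j
    have h3 := Ipos (j + 1)
    have : 1 / (2 * K) * (1 / l (u j)) ≤ tailInt l (u j) := by linarith
    rw [div_mul_eq_mul_div, one_mul, div_le_iff₀ (by positivity)] at this
    linarith
  -- eventual doubling
  set Qn : ℕ := 4 * q ^ 2 with hQn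
  have hev := (hlsv (u (Qn + 1)) (by have := hu1 (Qn + 1); linarith)).eventually_le_const
    (show (1:ℝ) < 2 by norm_num)
  obtain ⟨j0, hj0⟩ := eventually_atTop.mp (hut.eventually hev)
  refine ⟨1 / (2 * K), (q : ℝ) ^ 2, j0, by positivity, by positivity, Ipos, Ilim, apos, aanti,
    alim, lo, hi, ?_⟩
  intro j hj
  have h1 := hj0 j hj
  have pj : 0 < l (u j) := hlpos _ (by have := hu1 j; linarith)
  have hum2 : u (Qn + 1) * u j = u (j + Qn + 1) := by
    simp only [hu]; ring
  rw [div_le_iff₀ pj, hum2] at h1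
  have pj2 : 0 < l (u (j + Qn + 1)) := hlpos _ (by have := hu1 (j + Qn + 1); linarith)
  have h2 : 1 / 2 * (1 / l (u j)) ≤ 1 / l (u (j + Qn + 1)) := by
    rw [div_mul_div_comm, one_mul]
    exact one_div_le_one_div_of_le pj2 h1
  have h3 : ∀ i, i ≤ Qn → i * (1 / 2 * (1 / l (u (j + Qn + 1)))) ≤
      tailInt l (u (j + 1)) - tailInt l (u (j + 1 + i)) := by
    intro i
    induction i with
    | zero => intro _; simp
    | succ i ih =>
      intro hi'
      have g1 := ih (by omega)
      have g2 := lo2 (j + 1 + i)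
      have g3 : 1 / l (u (j + Qn + 1)) ≤ 1 / l (u (j + 1 + i + 1)) := aanti (by omega)
      push_cast
      have e : j + 1 + (i + 1) = j + 1 + i + 1 := by ring
      rw [e]
      nlinarith
  have h4 := h3 Qn le_rfl
  have h5 := Ipos (j + 1 + Qn)
  have h6 := hi j
  have h7 : (Qn : ℝ) = 4 * (q : ℝ) ^ 2 := by rw [hQn]; push_cast; ring
  rw [h7] at h4
  have h8 : 4 * (q : ℝ) ^ 2 * (1 / 2 * (1 / 2 * (1 / l (u j)))) ≤
      4 * (q : ℝ) ^ 2 * (1 / 2 * (1 / l (u (j + Qn + 1)))) := by gcongr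
  change tailInt l (u j) ≤ 2 * tailInt l (u (j + 1))
  nlinarith

end analysis
/-! ### Geometry -/

section geometry
variable {G : Type*} [Group G]

lemma exists_word {S : Set G} (hS : IsSymmGen S) (g : G) :
    ∃ w : List G, (∀ x ∈ w, x ∈ S) ∧ w.prod = g := by
  obtain ⟨_, hsym, hcl⟩ := hS
  have h1 : g ∈ Subgroup.closure S := by rw [hcl]; trivial
  rw [← Subgroup.mem_toSubmonoid, Subgroup.closure_toSubmonoid] at h1
  obtain ⟨w, hw, hp⟩ := Submonoid.exists_list_of_mem_closure h1
  refine ⟨w, fun x hx => ?_, hp⟩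
  rcases hw x hx with h | h
  · exact h
  · have := hsym _ (Set.mem_inv.mp h)
    rwa [inv_inv] at this

lemma wordLen_spec {S : Set G} (hS : IsSymmGen S) (g : G) :
    ∃ w : List G, (∀ x ∈ w, x ∈ S) ∧ w.length = wordLen S g ∧ w.prod = g := by
  obtain ⟨w, hw, hp⟩ := exists_word hS g
  exact Nat.sInf_mem (s := {n | ∃ w : List G, (∀ x ∈ w, x ∈ S) ∧ w.length = n ∧ w.prod = g})
    ⟨w.length, w, hw, rfl, hp⟩

lemma wordLen_le {S : Set G} (w : List G) (hw : ∀ x ∈ w, x ∈ S) :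
    wordLen S w.prod ≤ w.length :=
  Nat.sInf_le ⟨w, hw, rfl, rfl⟩

lemma wordLen_one (S : Set G) : wordLen S (1 : G) = 0 := by
  have := wordLen_le (S := S) ([] : List G) (by simp)
  simpa using this

lemma wordLen_mul {S : Set G} (hS : IsSymmGen S) (x y : G) :
    wordLen S (x * y) ≤ wordLen S x + wordLen S y := by
  obtain ⟨w, hw, hl, hp⟩ := wordLen_spec hS x
  obtain ⟨w', hw', hl', hp'⟩ := wordLen_spec hS y
  have := wordLen_le (S := S) (w ++ w') (by
    intro z hz
    rcases List.mem_append.mp hz with h | h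
    · exact hw z h
    · exact hw' z h)
  rw [List.prod_append, List.length_append, hp, hp', hl, hl'] at this
  exact this

/-- Ball data. -/
structure BallData (len : G → ℕ) (D : ℕ) (cV CV : ℝ) (Bs : ℕ → Finset G) : Prop where
  one : len 1 = 0
  mul : ∀ x y, len (x * y) ≤ len x + len y
  hcV : 0 < cV
  hCV : 0 < CV
  mem : ∀ R : ℕ, 1 ≤ R → ∀ g, g ∈ Bs R ↔ len g ≤ R
  hi : ∀ R : ℕ, 1 ≤ R → ((Bs R).card : ℝ) ≤ CV * (R : ℝ) ^ D
  lo : ∀ R : ℕ, 1 ≤ R → cV * (R : ℝ) ^ D ≤ ((Bs R).card : ℝ)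

lemma ballData {S : Set G} (hS : IsSymmGen S) {D : ℕ} (hD : PolyGrowth S D) :
    ∃ cV CV Bs, BallData (wordLen S) D cV CV Bs := by
  obtain ⟨cV, CV, hc, hC, hv⟩ := hD
  have hfin : ∀ R : ℕ, 1 ≤ R → {g : G | wordLen S g ≤ R}.Finite := by
    intro R hR
    by_contra hinf
    have h0 : vol S R = 0 := Set.Infinite.ncard hinf
    have h1 := (hv R hR).1
    rw [h0] at h1
    have : (0:ℝ) < R := by exact_mod_cast hR
    have : 0 < cV * (R : ℝ) ^ D := by positivity
    simp at h1
    linarith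
  refine ⟨cV, CV, fun R => if h : 1 ≤ R then (hfin R h).toFinset else ∅, wordLen_one S,
    wordLen_mul hS, hc, hC, ?_, ?_, ?_⟩
  · intro R hR g
    simp [hR]
  · intro R hR
    have := (hv R hR).2
    rw [vol, Set.ncard_eq_toFinset_card _ (hfin R hR)] at this
    simpa [hR] using this
  · intro R hR
    have := (hv R hR).1
    rw [vol, Set.ncard_eq_toFinset_card _ (hfin R hR)] at this
    simpa [hR] using this

variable {len : G → ℕ} {D : ℕ} {cV CV : ℝ} {Bs : ℕ → Finset G} {l : ℝ → ℝ} {η : G → ℝ}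
  {q : ℕ} {c C : ℝ}

/-- Pointwise comparison of a density with the model density. -/
def ModelBound (len : G → ℕ) (D : ℕ) (l : ℝ → ℝ) (η : G → ℝ) (c C : ℝ) : Prop :=
  ∀ g : G, c / ((1 + (len g : ℝ)) ^ D * l (1 + (len g : ℝ) ^ 2)) ≤ η g ∧
      η g ≤ C / ((1 + (len g : ℝ)) ^ D * l (1 + (len g : ℝ) ^ 2))

lemma point_hi (hlpos : ∀ x, 0 ≤ x → 0 < l x) (hlmono : MonotoneOn l (Set.Ici 0))
    (hC : 0 < C) (hq : 4 ≤ q) (hm : ModelBound len D l η c C) (j : ℕ) (g : G)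
    (hg : q ^ j < len g) :
    η g ≤ C * ((q : ℝ) ^ (j * D))⁻¹ * (1 / l (((q : ℝ) ^ j) ^ 2)) := by
  have hq0 : (4 : ℝ) ≤ q := by exact_mod_cast hq
  have h1 : (q : ℝ) ^ j ≤ len g := by exact_mod_cast hg.le
  have p1 := hlpos (((q : ℝ) ^ j) ^ 2) (by positivity)
  have h2 : l (((q : ℝ) ^ j) ^ 2) ≤ l (1 + (len g : ℝ) ^ 2) := by
    refine hlmono (by simp only [Set.mem_Ici]; positivity)
      (by simp only [Set.mem_Ici]; positivity) ?_
    have : ((q : ℝ) ^ j) ^ 2 ≤ (len g : ℝ) ^ 2 := by gcongr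
    linarith
  refine (hm g).2.trans ?_
  have e : C * ((q : ℝ) ^ (j * D))⁻¹ * (1 / l (((q : ℝ) ^ j) ^ 2)) =
      C / (((q : ℝ) ^ j) ^ D * l (((q : ℝ) ^ j) ^ 2)) := by
    rw [pow_mul (q : ℝ) j D]; field_simp
  rw [e]
  have : (q : ℝ) ^ j ≤ 1 + len g := by linarith
  gcongr

lemma point_lo (hlpos : ∀ x, 0 ≤ x → 0 < l x) (hlmono : MonotoneOn l (Set.Ici 0))
    (hc : 0 < c) (hq : 4 ≤ q) (hm : ModelBound len D l η c C) (K : ℝ) (hK : 0 < K)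
    (hKd : ∀ x, 0 ≤ x → l ((2 * (q : ℝ) ^ 2) * x) ≤ K * l x) (j : ℕ) (g : G)
    (hg : len g ≤ q ^ (j + 1)) :
    c / ((2 * (q : ℝ)) ^ D * K) * ((q : ℝ) ^ (j * D))⁻¹ * (1 / l (((q : ℝ) ^ j) ^ 2)) ≤ η g := by
  have hq0 : (4 : ℝ) ≤ q := by exact_mod_cast hq
  have h1 : (len g : ℝ) ≤ (q : ℝ) ^ (j + 1) := by exact_mod_cast hg
  have h1q : 1 ≤ (q : ℝ) ^ (j + 1) := one_le_pow₀ (by linarith)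
  have p1 := hlpos (((q : ℝ) ^ j) ^ 2) (by positivity)
  have p2 := hlpos (1 + (len g : ℝ) ^ 2) (by positivity)
  have h2 : l (1 + (len g : ℝ) ^ 2) ≤ K * l (((q : ℝ) ^ j) ^ 2) := by
    refine le_trans ?_ (hKd _ (by positivity))
    refine hlmono (by simp only [Set.mem_Ici]; positivity)
      (by simp only [Set.mem_Ici]; positivity) ?_
    have : (len g : ℝ) ^ 2 ≤ ((q : ℝ) ^ (j + 1)) ^ 2 := by gcongr
    have h3 : 1 ≤ ((q : ℝ) ^ (j + 1)) ^ 2 := one_le_pow₀ h1q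
    have e : 2 * (q : ℝ) ^ 2 * ((q : ℝ) ^ j) ^ 2 = 2 * ((q : ℝ) ^ (j + 1)) ^ 2 := by ring
    rw [e]; linarith
  refine le_trans ?_ (hm g).1
  have e : c / ((2 * (q : ℝ)) ^ D * K) * ((q : ℝ) ^ (j * D))⁻¹ * (1 / l (((q : ℝ) ^ j) ^ 2)) =
      c / ((2 * (q : ℝ) * (q : ℝ) ^ j) ^ D * (K * l (((q : ℝ) ^ j) ^ 2))) := by
    rw [mul_pow (2 * (q : ℝ)), pow_mul (q : ℝ) j D]; field_simp
  rw [e]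
  have : 1 + (len g : ℝ) ≤ 2 * (q : ℝ) * (q : ℝ) ^ j := by
    have : 2 * (q : ℝ) * (q : ℝ) ^ j = 2 * (q : ℝ) ^ (j + 1) := by ring
    rw [this]; linarith
  gcongr

lemma tsum_ball (hb : BallData len D cV CV Bs) (R : ℕ) (hR : 1 ≤ R) (η : G → ℝ) :
    ∑' g, (if len g ≤ R then η g else 0) = ∑ g ∈ Bs R, η g := by
  rw [tsum_eq_sum (s := Bs R)]
  · refine Finset.sum_congr rfl (fun g hg => ?_)
    rw [hb.mem R hR] at hg
    simp [hg]
  · intro g hg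
    rw [hb.mem R hR] at hg
    simp [hg]

lemma tsum_split (hη : Good η) (R : ℕ) :
    ∑' g, (if len g ≤ R then η g else 0) + ∑' g, (if R < len g then η g else 0) = ∑' g, η g := by
  rw [← (good_ite hη (fun g => len g ≤ R)).sm.tsum_add (good_ite hη (fun g => R < len g)).sm]
  congr 1; ext g
  by_cases h : len g ≤ R
  · simp [h, not_lt.mpr h]
  · simp [h, not_le.mp h]

lemma one_le_qpow (hq : 4 ≤ q) (j : ℕ) : 1 ≤ q ^ j := Nat.one_le_pow _ _ (by omega)

lemma balls_subset (hb : BallData len D cV CV Bs) (hq : 4 ≤ q) {i j : ℕ} (hij : i ≤ j) :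
    Bs (q ^ i) ⊆ Bs (q ^ j) := by
  intro g hg
  rw [hb.mem _ (one_le_qpow hq _)] at hg ⊢
  exact hg.trans (Nat.pow_le_pow_right (by omega) hij)

lemma shell_eq (hb : BallData len D cV CV Bs) (hq : 4 ≤ q) (j : ℕ) (η : G → ℝ) :
    ∑' g, (if len g ≤ q ^ (j + 1) then η g else 0) - ∑' g, (if len g ≤ q ^ j then η g else 0) =
      ∑ g ∈ Bs (q ^ (j + 1)) \ Bs (q ^ j), η g := by
  rw [tsum_ball hb _ (one_le_qpow hq _), tsum_ball hb _ (one_le_qpow hq _),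
    ← Finset.sum_sdiff (balls_subset hb hq (Nat.le_succ j))]
  ring

lemma shell_hi (hb : BallData len D cV CV Bs)
    (hlpos : ∀ x, 0 ≤ x → 0 < l x) (hlmono : MonotoneOn l (Set.Ici 0))
    (hC : 0 < C) (hq : 4 ≤ q) (hm : ModelBound len D l η c C) (j : ℕ) :
    ∑' g, (if len g ≤ q ^ (j + 1) then η g else 0) - ∑' g, (if len g ≤ q ^ j then η g else 0) ≤
      CV * (q : ℝ) ^ D * C * (1 / l (((q : ℝ) ^ j) ^ 2)) := by
  rw [shell_eq hb hq]
  have hq0 : (4 : ℝ) ≤ q := by exact_mod_cast hq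
  have p1 := hlpos (((q : ℝ) ^ j) ^ 2) (by positivity)
  have hCV := hb.hCV
  have h1 : ∀ g ∈ Bs (q ^ (j + 1)) \ Bs (q ^ j), η g ≤
      C * ((q : ℝ) ^ (j * D))⁻¹ * (1 / l (((q : ℝ) ^ j) ^ 2)) := by
    intro g hg
    rw [Finset.mem_sdiff, hb.mem _ (one_le_qpow hq _), hb.mem _ (one_le_qpow hq _), not_le] at hg
    exact point_hi hlpos hlmono hC hq hm j g hg.2
  refine (Finset.sum_le_card_nsmul _ _ _ h1).trans ?_
  rw [nsmul_eq_mul]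
  have h2 : ((Bs (q ^ (j + 1)) \ Bs (q ^ j)).card : ℝ) ≤ CV * ((q : ℝ) ^ (j + 1)) ^ D := by
    have h3 := hb.hi (q ^ (j + 1)) (one_le_qpow hq _)
    push_cast at h3
    refine le_trans ?_ h3
    exact_mod_cast Finset.card_le_card Finset.sdiff_subset
  calc _ ≤ CV * ((q : ℝ) ^ (j + 1)) ^ D *
        (C * ((q : ℝ) ^ (j * D))⁻¹ * (1 / l (((q : ℝ) ^ j) ^ 2))) := by gcongr
    _ = _ := by
      rw [← pow_mul, add_mul, one_mul, pow_add]
      field_simp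

lemma shell_lo (hb : BallData len D cV CV Bs)
    (hlpos : ∀ x, 0 ≤ x → 0 < l x) (hlmono : MonotoneOn l (Set.Ici 0))
    (hc : 0 < c) (hq : 4 ≤ q) (hqV : 2 * CV ≤ cV * (q : ℝ) ^ D)
    (hm : ModelBound len D l η c C) (K : ℝ) (hK : 0 < K)
    (hKd : ∀ x, 0 ≤ x → l ((2 * (q : ℝ) ^ 2) * x) ≤ K * l x) (j : ℕ) :
    CV * (c / ((2 * (q : ℝ)) ^ D * K)) * (1 / l (((q : ℝ) ^ j) ^ 2)) ≤
    ∑' g, (if len g ≤ q ^ (j + 1) then η g else 0) -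
      ∑' g, (if len g ≤ q ^ j then η g else 0) := by
  rw [shell_eq hb hq]
  have hq0 : (4 : ℝ) ≤ q := by exact_mod_cast hq
  have p1 := hlpos (((q : ℝ) ^ j) ^ 2) (by positivity)
  have hCV := hb.hCV
  have h1 : ∀ g ∈ Bs (q ^ (j + 1)) \ Bs (q ^ j),
      c / ((2 * (q : ℝ)) ^ D * K) * ((q : ℝ) ^ (j * D))⁻¹ * (1 / l (((q : ℝ) ^ j) ^ 2)) ≤ η g := by
    intro g hg
    rw [Finset.mem_sdiff, hb.mem _ (one_le_qpow hq _), hb.mem _ (one_le_qpow hq _), not_le] at hg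
    exact point_lo hlpos hlmono hc hq hm K hK hKd j g hg.1
  refine le_trans ?_ (Finset.card_nsmul_le_sum _ _ _ h1)
  rw [nsmul_eq_mul]
  have h2 : CV * (q : ℝ) ^ (j * D) ≤ ((Bs (q ^ (j + 1)) \ Bs (q ^ j)).card : ℝ) := by
    have h3 := hb.lo (q ^ (j + 1)) (one_le_qpow hq _)
    have h4 := hb.hi (q ^ j) (one_le_qpow hq _)
    have h5 := Finset.card_sdiff_add_card_eq_card (balls_subset hb hq (Nat.le_succ j))
    have h6 : ((Bs (q ^ (j + 1)) \ Bs (q ^ j)).card : ℝ) + ((Bs (q ^ j)).card : ℝ) =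
        ((Bs (q ^ (j + 1))).card : ℝ) := by exact_mod_cast h5
    push_cast at h3 h4
    rw [← pow_mul, add_mul, one_mul, pow_add] at h3
    rw [← pow_mul] at h4
    have h7 := mul_le_mul_of_nonneg_right hqV (show (0:ℝ) ≤ (q : ℝ) ^ (j * D) by positivity)
    linarith
  calc _ = CV * (q : ℝ) ^ (j * D) *
      (c / ((2 * (q : ℝ)) ^ D * K) * ((q : ℝ) ^ (j * D))⁻¹ * (1 / l (((q : ℝ) ^ j) ^ 2))) := by
        field_simp
    _ ≤ _ := by gcongr

lemma ball_tendsto (hb : BallData len D cV CV Bs) (hq : 4 ≤ q) (hη : Good η) :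
    Tendsto (fun k : ℕ => ∑' g, (if q ^ k < len g then η g else 0)) atTop (𝓝 0) := by
  have h1 : Tendsto (fun k : ℕ => Bs (q ^ k)) atTop atTop := by
    refine tendsto_atTop_finset_of_monotone (fun i j hij => balls_subset hb hq hij) (fun g => ?_)
    refine ⟨len g, ?_⟩
    rw [hb.mem _ (one_le_qpow hq _)]
    exact (Nat.lt_pow_self (by omega)).le
  have h2 := hη.sm.hasSum.comp h1
  have h3 := h2.const_sub (∑' g, η g)
  rw [sub_self] at h3
  refine h3.congr (fun k => ?_)
  have := tsum_split (len := len) hη (q ^ k)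
  rw [tsum_ball hb _ (one_le_qpow hq _)] at this
  simp only [Function.comp]
  linarith

lemma tail_hi (hb : BallData len D cV CV Bs) {c3 c4 : ℝ} {j0 : ℕ} (hsd : SeqData l q c3 c4 j0)
    (hlpos : ∀ x, 0 ≤ x → 0 < l x) (hlmono : MonotoneOn l (Set.Ici 0))
    (hC : 0 < C) (hq : 4 ≤ q) (hη : Good η) (hm : ModelBound len D l η c C) (j : ℕ) :
    ∑' g, (if q ^ j < len g then η g else 0) ≤
      (CV * (q : ℝ) ^ D * C / c3) * tailInt l (((q : ℝ) ^ j) ^ 2) := by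
  have hc3 := hsd.hc3
  have hCV := hb.hCV
  set A := CV * (q : ℝ) ^ D * C / c3 with hA
  have hA0 : 0 < A := by
    have : (0:ℝ) < q := by exact_mod_cast (show 0 < q by omega)
    positivity
  set F : ℕ → ℝ := fun k => A * tailInt l (((q : ℝ) ^ k) ^ 2) -
    ∑' g, (if q ^ k < len g then η g else 0) with hF
  have hanti : Antitone F := by
    refine antitone_nat_of_succ_le (fun k => ?_)
    have h1 := shell_hi hb hlpos hlmono hC hq hm k
    have h2 := tsum_split (len := len) hη (q ^ k)
    have h3 := tsum_split (len := len) hη (q ^ (k + 1))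
    have h4 := mul_le_mul_of_nonneg_left (hsd.lo k) hA0.le
    have h5 : A * (c3 * (1 / l (((q : ℝ) ^ k) ^ 2))) =
        CV * (q : ℝ) ^ D * C * (1 / l (((q : ℝ) ^ k) ^ 2)) := by
      rw [hA]; field_simp
    simp only [hF]
    linarith
  have hlim : Tendsto F atTop (𝓝 0) := by
    have := (hsd.Ilim.const_mul A).sub (ball_tendsto hb hq hη)
    simpa using this
  have := hanti.le_of_tendsto hlim j
  simp only [hF] at this
  linarith

lemma tail_lo {c3 c4 : ℝ} {j0 : ℕ} (hsd : SeqData l q c3 c4 j0)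
    (hη : Good η) (cs : ℝ) (hcs : 0 < cs)
    (hsh : ∀ j : ℕ, cs * (1 / l (((q : ℝ) ^ j) ^ 2)) ≤
      ∑' g, (if len g ≤ q ^ (j + 1) then η g else 0) -
        ∑' g, (if len g ≤ q ^ j then η g else 0)) (j : ℕ) :
    (cs / c4) * tailInt l (((q : ℝ) ^ j) ^ 2) ≤ ∑' g, (if q ^ j < len g then η g else 0) := by
  have hc4 := hsd.hc4
  set A := cs / c4 with hA
  have hA0 : 0 < A := by positivity
  set F : ℕ → ℝ := fun k => ∑' g, (if q ^ k < len g then η g else 0) -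
    A * tailInt l (((q : ℝ) ^ k) ^ 2) with hF
  have hanti : Antitone F := by
    refine antitone_nat_of_succ_le (fun k => ?_)
    have h1 := hsh k
    have h2 := tsum_split (len := len) hη (q ^ k)
    have h3 := tsum_split (len := len) hη (q ^ (k + 1))
    have h4 := mul_le_mul_of_nonneg_left (hsd.hi k) hA0.le
    have h5 : A * (c4 * (1 / l (((q : ℝ) ^ k) ^ 2))) = cs * (1 / l (((q : ℝ) ^ k) ^ 2)) := by
      rw [hA]; field_simp
    simp only [hF]
    linarith
  have hlim : Tendsto (fun k : ℕ => -(A * tailInt l (((q : ℝ) ^ k) ^ 2))) atTop (𝓝 0) := by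
    have := (hsd.Ilim.const_mul A).neg
    simpa using this
  have h0 : 0 ≤ F j := by
    refine le_of_tendsto hlim ?_
    filter_upwards [eventually_ge_atTop j] with k hk
    have h1 := hanti hk
    have h2 : 0 ≤ ∑' g, (if q ^ k < len g then η g else 0) :=
      (good_ite hη (fun g => q ^ k < len g)).tsum_nn
    simp only [hF] at h1 ⊢
    linarith
  simp only [hF] at h0
  linarith

/-- The main comparison. -/
lemma compare_main (hb : BallData len D cV CV Bs) {c3 c4 : ℝ} {j0 : ℕ}
    (hsd : SeqData l q c3 c4 j0)
    (hlpos : ∀ x, 0 ≤ x → 0 < l x) (hlmono : MonotoneOn l (Set.Ici 0)) (hlsv : SlowlyVarying l)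
    (hc : 0 < c) (hC : 0 < C) (hq : 4 ≤ q) (hqV : 1 ≤ D → 2 * CV ≤ cV * (q : ℝ) ^ D)
    (hη : Good η) (hη1 : ∑' g, η g = 1) (hm : ModelBound len D l η c C) (B : ℝ) (hB : 0 < B) :
    ∃ (N : ℕ) (c' : ℝ), 0 < N ∧ 0 < c' ∧ ∀ μ : G → ℝ, Good μ → (∑' g, μ g = 1) →
      (∀ g, μ g⁻¹ = μ g) →
      (∀ j, ∑' g, (if q ^ j < len g then μ g else 0) ≤ B * tailInt l (((q : ℝ) ^ j) ^ 2)) →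
      ∀ n m : ℕ, 2 * N * n ≤ m → c' * convPow η m 1 ≤ convPow μ (2 * n) 1 := by
  have hCV := hb.hCV
  have hq0 : (4 : ℝ) ≤ q := by exact_mod_cast hq
  have hle1 : ∀ m, convPow η m 1 ≤ 1 := by
    intro m
    have := (convPow_good hη m).le_tsum 1
    rwa [tsum_convPow hη m, hη1, one_pow] at this
  have hnn : ∀ m, 0 ≤ convPow η m 1 := fun m => (convPow_good hη m).nn 1
  rcases Nat.eq_zero_or_pos D with hD0 | hDpos
  · -- bounded volume
    refine ⟨1, 1 / (4 * CV), one_pos, by positivity, ?_⟩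
    intro μ hμ hμ1 hμs _ n m _
    have gn := convPow_good hμ n
    have h1 := (ball_tendsto hb hq gn).eventually_lt_const (show (0:ℝ) < 1 / 2 by norm_num)
    obtain ⟨k, hk⟩ := h1.exists
    have h2 := tsum_split (len := len) gn (q ^ k)
    rw [tsum_ball hb _ (one_le_qpow hq _), tsum_convPow hμ n, hμ1, one_pow] at h2
    have h3 := return_lower hμ hμs n (Bs (q ^ k)) (1 / 2) (by norm_num) (by linarith)
    have h4 := hb.hi (q ^ k) (one_le_qpow hq _)
    rw [hD0, pow_zero, mul_one] at h4
    have h5 : 0 ≤ convPow μ (2 * n) 1 := (convPow_good hμ _).nn 1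
    have h6 := mul_le_mul_of_nonneg_right h4 h5
    have h7 := hle1 m
    rw [div_mul_eq_mul_div, one_mul, div_le_iff₀ (by positivity)]
    nlinarith
  · obtain ⟨K, hK, hKd⟩ := l_doubling hlpos hlmono hlsv (2 * (q : ℝ) ^ 2) (by positivity)
    set cs := CV * (c / ((2 * (q : ℝ)) ^ D * K)) with hcs
    have hcs0 : 0 < cs := by positivity
    have hsh := shell_lo hb hlpos hlmono hc hq (hqV hDpos) hm K hK hKd
    rw [← hcs] at hsh
    obtain ⟨c1, C1, k0, hc1, hC1, hlow⟩ := lower_bound len hb.one hb.mul D CV hCV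
      (fun R hR => ⟨Bs R, hb.mem R hR, hb.hi R hR⟩) q hq _ hsd.Ipos hsd.Ilim j0 hsd.db B hB
    have hc4 := hsd.hc4
    obtain ⟨N, C', hN, hC', hup⟩ := upper_bound len D hDpos q hq _ _ hsd.apos hsd.aanti hsd.alim
      c3 c4 hsd.hc3 hsd.hc4 hsd.lo hsd.hi hsd.Ipos η hη hη1 (cs / c4) (C / cs) (by positivity)
      (by positivity) (tail_lo hsd hη cs hcs0 hsh) (by
        intro k g hg
        refine (point_hi hlpos hlmono hC hq hm k g hg).trans ?_
        have h1 := hsh k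
        calc _ = C / cs * ((q : ℝ) ^ (k * D))⁻¹ * (cs * (1 / l (((q : ℝ) ^ k) ^ 2))) := by
              field_simp
          _ ≤ _ := by gcongr) C1 hC1 k0
    refine ⟨N, min 1 (c1 / C'), hN, by positivity, ?_⟩
    intro μ hμ hμ1 hμs htail n m hnm
    rcases Nat.eq_zero_or_pos n with hn | hn
    · subst hn
      have e : convPow μ (2 * 0) 1 = 1 := by simp [convPow]
      rw [e]
      have h1 : min 1 (c1 / C') ≤ 1 := min_le_left _ _
      calc _ ≤ 1 * convPow η m 1 := by gcongr; exact hnn m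
        _ ≤ 1 := by rw [one_mul]; exact hle1 m
    · obtain ⟨k, hk, hk2⟩ := hup n hn
      have h1 := hk2 m hnm 1
      have h2 := hlow μ hμ hμ1 hμs htail k hk n
      refine le_trans ?_ h2
      have h3 : min 1 (c1 / C') ≤ c1 / C' := min_le_right _ _
      calc _ ≤ (c1 / C') * convPow η m 1 := by gcongr; exact hnn m
        _ ≤ (c1 / C') * (C' * _) := by gcongr
        _ = _ := by field_simp

end geometry
/-! ### Weak moments and the conclusion -/

section final
variable {G : Type*} [Group G]

lemma massOf_le {f : G → ℝ} (hf : Good f) (A : Set G) (P : G → Prop) [DecidablePred P]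
    (h : ∀ g ∈ A, P g) : massOf f A ≤ ∑' g, (if P g then f g else 0) := by
  unfold massOf
  rw [tsum_subtype A f]
  refine Summable.tsum_le_tsum (fun g => ?_) (hf.sm.indicator A) (good_ite hf P).sm
  by_cases hg : g ∈ A
  · simp [hg, h g hg]
  · rw [Set.indicator_of_notMem hg]
    split_ifs
    · exact hf.nn g
    · exact le_refl _

lemma le_massOf {f : G → ℝ} (hf : Good f) (A : Set G) (P : G → Prop) [DecidablePred P]
    (h : ∀ g, P g → g ∈ A) : ∑' g, (if P g then f g else 0) ≤ massOf f A := by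
  unfold massOf
  rw [tsum_subtype A f]
  refine Summable.tsum_le_tsum (fun g => ?_) (good_ite hf P).sm (hf.sm.indicator A)
  by_cases hg : P g
  · simp [hg, h g hg]
  · simp only [hg, if_false]
    exact Set.indicator_nonneg (fun x _ => hf.nn x) g

variable {l : ℝ → ℝ} {q : ℕ} {c3 c4 : ℝ} {j0 : ℕ} {S : Set G}

lemma weak_to_tail (hlpos : ∀ x, 0 ≤ x → 0 < l x) (hlmono : MonotoneOn l (Set.Ici 0))
    (hlint : IntegrableOn (fun t => 1 / (t * l t)) (Set.Ioi 1)) (hq : 4 ≤ q)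
    (hsd : SeqData l q c3 c4 j0) {μ : G → ℝ} (hμ : Good μ)
    (hw : WeakMomentLe S (fun s => thetaOf l (s ^ 2) / 2) μ 2) (j : ℕ) :
    ∑' g, (if q ^ j < wordLen S g then μ g else 0) ≤ 8 * tailInt l (((q : ℝ) ^ j) ^ 2) := by
  have hI := hsd.Ipos j
  have hq0 : (4 : ℝ) ≤ q := by exact_mod_cast hq
  set I := tailInt l (((q : ℝ) ^ j) ^ 2) with hIdef
  have h1 := hw (1 / (4 * I)) (by positivity)
  have h2 := le_massOf hμ {g | (fun s => thetaOf l (s ^ 2) / 2) ((wordLen S g : ℝ)) > 1 / (4 * I)}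
    (fun g => q ^ j < wordLen S g) (by
      intro g hg
      have hg' : (q : ℝ) ^ j ≤ wordLen S g := by exact_mod_cast hg.le
      have hq1 : 1 ≤ (q : ℝ) ^ j := one_le_pow₀ (by linarith)
      have a1 : 1 ≤ ((q : ℝ) ^ j) ^ 2 := one_le_pow₀ hq1
      have a2 : ((q : ℝ) ^ j) ^ 2 ≤ (wordLen S g : ℝ) ^ 2 := by gcongr
      have a3 := tailInt_anti hlpos hlint a1 a2
      have a4 := tailInt_pos hlpos hlmono hlint (a1.trans a2)
      simp only [Set.mem_setOf_eq, thetaOf_eq, gt_iff_lt]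
      rw [div_div, div_lt_div_iff₀ (by positivity) (by positivity)]
      linarith)
  rw [div_mul_eq_mul_div, one_mul, div_le_iff₀ (by positivity)] at h1
  linarith

lemma I_ratio (hsd : SeqData l q c3 c4 j0) :
    ∃ Kd : ℝ, 0 < Kd ∧ ∀ j : ℕ, tailInt l (((q : ℝ) ^ j) ^ 2) ≤
      Kd * tailInt l (((q : ℝ) ^ (j + 1)) ^ 2) := by
  have hanti : Antitone (fun j : ℕ => tailInt l (((q : ℝ) ^ j) ^ 2)) := by
    refine antitone_nat_of_succ_le (fun k => ?_)
    have h1 := hsd.lo k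
    have h2 := mul_pos hsd.hc3 (hsd.apos k)
    linarith
  have p0 := hsd.Ipos 0
  have pj := hsd.Ipos j0
  refine ⟨max 2 (tailInt l (((q : ℝ) ^ 0) ^ 2) / tailInt l (((q : ℝ) ^ j0) ^ 2)),
    lt_max_of_lt_left two_pos, fun j => ?_⟩
  have pj1 := hsd.Ipos (j + 1)
  by_cases h : j0 ≤ j
  · refine (hsd.db j h).trans ?_
    gcongr
    exact le_max_left _ _
  · have h1 : tailInt l (((q : ℝ) ^ j) ^ 2) ≤ tailInt l (((q : ℝ) ^ 0) ^ 2) :=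
      hanti (Nat.zero_le j)
    have h2 : tailInt l (((q : ℝ) ^ j0) ^ 2) ≤ tailInt l (((q : ℝ) ^ (j + 1)) ^ 2) :=
      hanti (show j + 1 ≤ j0 by omega)
    calc _ ≤ tailInt l (((q : ℝ) ^ 0) ^ 2) := h1
      _ = tailInt l (((q : ℝ) ^ 0) ^ 2) / tailInt l (((q : ℝ) ^ j0) ^ 2) *
          tailInt l (((q : ℝ) ^ j0) ^ 2) := by field_simp
      _ ≤ _ := by
        gcongr
        exact le_max_right _ _

lemma tail_to_weak (hlpos : ∀ x, 0 ≤ x → 0 < l x) (hlmono : MonotoneOn l (Set.Ici 0))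
    (hlint : IntegrableOn (fun t => 1 / (t * l t)) (Set.Ioi 1)) (hq : 4 ≤ q)
    (hsd : SeqData l q c3 c4 j0) {μ : G → ℝ} (hμ : Good μ) (hμ1 : ∑' g, μ g = 1)
    (Ct : ℝ) (hCt : 0 < Ct)
    (htail : ∀ j, ∑' g, (if q ^ j < wordLen S g then μ g else 0) ≤
      Ct * tailInt l (((q : ℝ) ^ j) ^ 2)) :
    ∃ K : ℝ, 0 < K ∧ WeakMomentLe S (fun s => thetaOf l (s ^ 2) / 2) μ K := by
  obtain ⟨Kd, hKd, hrat⟩ := I_ratio hsd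
  have hq0 : (4 : ℝ) ≤ q := by exact_mod_cast hq
  have p1 := tailInt_pos hlpos hlmono hlint (le_refl 1)
  refine ⟨max (1 / (2 * tailInt l 1)) (Ct * Kd / 2), lt_max_of_lt_left (by positivity), ?_⟩
  intro s hs
  set A : Set G := {g | (fun s => thetaOf l (s ^ 2) / 2) ((wordLen S g : ℝ)) > s} with hA
  by_cases hne : A.Nonempty
  · have hex : ∃ r, ∃ g ∈ A, wordLen S g = r := by
      obtain ⟨g, hg⟩ := hne
      exact ⟨_, g, hg, rfl⟩
    set r := Nat.find hex with hr
    obtain ⟨g, hgA, hgr⟩ := Nat.find_spec hex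
    rw [← hr] at hgr
    have hmin : ∀ x ∈ A, r ≤ wordLen S x := fun x hx => Nat.find_min' hex ⟨x, hx, rfl⟩
    have hsr : s < thetaOf l ((r : ℝ) ^ 2) / 2 := by
      have := hgA
      simp only [hA, Set.mem_setOf_eq, hgr] at this
      exact this
    have hr1 : 1 ≤ r := by
      by_contra h0
      have h0 : r = 0 := by omega
      rw [h0] at hsr
      simp [thetaOf_zero] at hsr
      linarith
    rcases Nat.eq_or_lt_of_le hr1 with h | h
    · refine le_trans ?_ (le_max_left _ _)
      rw [← h] at hsr
      have h2 := massOf_le hμ A (fun _ => True) (fun _ _ => trivial)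
      simp only [if_true, hμ1] at h2
      rw [thetaOf_eq, div_div] at hsr
      simp only [Nat.cast_one, one_pow] at hsr
      calc s * massOf μ A ≤ s * 1 := by gcongr
        _ ≤ _ := by rw [mul_one]; rw [mul_comm] at hsr; exact hsr.le
    · refine le_trans ?_ (le_max_right _ _)
      have hpos : 0 < Nat.clog q r := Nat.clog_pos (by omega) (by omega)
      have b1 := Nat.pow_pred_clog_lt_self (b := q) (x := r) (by omega) (by omega)
      have b2 := Nat.le_pow_clog (b := q) (by omega) r
      obtain ⟨j, hj⟩ : ∃ j, Nat.clog q r = j + 1 := ⟨Nat.clog q r - 1, by omega⟩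
      rw [hj] at b1 b2
      simp only [Nat.pred_eq_sub_one, Nat.add_sub_cancel] at b1
      have h2 := (massOf_le hμ A (fun g => q ^ j < wordLen S g)
        (fun x hx => lt_of_lt_of_le b1 (hmin x hx))).trans (htail j)
      have a0 : (1 : ℝ) ≤ r := by exact_mod_cast hr1
      have a1 : (1 : ℝ) ≤ (r : ℝ) ^ 2 := one_le_pow₀ a0
      have a2 : (r : ℝ) ≤ (q : ℝ) ^ (j + 1) := by exact_mod_cast b2
      have a3 : (r : ℝ) ^ 2 ≤ ((q : ℝ) ^ (j + 1)) ^ 2 := by gcongr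
      have a4 := tailInt_anti hlpos hlint a1 a3
      have a5 := hsd.Ipos (j + 1)
      have a6 : s ≤ 1 / (2 * tailInt l (((q : ℝ) ^ (j + 1)) ^ 2)) := by
        refine hsr.le.trans ?_
        rw [thetaOf_eq, div_div, mul_comm]
        gcongr
      have a7 := hrat j
      calc s * massOf μ A ≤ s * (Ct * tailInt l (((q : ℝ) ^ j) ^ 2)) := by gcongr
        _ ≤ 1 / (2 * tailInt l (((q : ℝ) ^ (j + 1)) ^ 2)) *
            (Ct * (Kd * tailInt l (((q : ℝ) ^ (j + 1)) ^ 2))) := by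
              have := hsd.Ipos j
              gcongr
        _ = _ := by field_simp
  · rw [Set.not_nonempty_iff_eq_empty] at hne
    rw [hne]
    have : massOf μ (∅ : Set G) = 0 := by simp [massOf]
    rw [this, mul_zero]
    exact le_max_of_le_right (by positivity)

/-- Lazy version of a density. -/
def lazy (ε : ℝ) (φ : G → ℝ) : G → ℝ := fun g => (if g = 1 then 1 - ε else 0) + ε * φ g

lemma lazy_symm {φ : G → ℝ} (hφ : IsSymmProb φ) (ε : ℝ) (h0 : 0 ≤ ε) (h1 : ε ≤ 1) :
    IsSymmProb (lazy ε φ) := by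
  obtain ⟨nn, sm, t1, sy⟩ := hφ
  have hs : Summable (fun g : G => if g = 1 then 1 - ε else 0) :=
    (hasSum_ite_eq (1 : G) (1 - ε)).summable
  refine ⟨fun g => ?_, hs.add (sm.mul_left ε), ?_, fun g => ?_⟩
  · have := mul_nonneg h0 (nn g)
    unfold lazy
    split_ifs <;> linarith
  · unfold lazy
    rw [hs.tsum_add (sm.mul_left ε), tsum_mul_left, t1, tsum_ite_eq]
    ring
  · simp [lazy, sy]

lemma lazy_weak {φ : G → ℝ} {ε K : ℝ} (h0 : 0 ≤ ε) (hεK : ε * K ≤ 2)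
    (hw : WeakMomentLe S (fun s => thetaOf l (s ^ 2) / 2) φ K) :
    WeakMomentLe S (fun s => thetaOf l (s ^ 2) / 2) (lazy ε φ) 2 := by
  intro s hs
  have h1 := hw s hs
  set A : Set G := {g | (fun s => thetaOf l (s ^ 2) / 2) ((wordLen S g : ℝ)) > s} with hA
  have h2 : massOf (lazy ε φ) A = ε * massOf φ A := by
    unfold massOf
    rw [← tsum_mul_left]
    congr 1; ext g
    have : (g : G) ≠ 1 := by
      intro h
      have hg := g.2
      simp only [hA, Set.mem_setOf_eq, h, wordLen_one] at hg
      simp [thetaOf_zero] at hg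
      linarith
    simp [lazy, this]
  rw [h2]
  calc _ = ε * (s * massOf φ A) := by ring
    _ ≤ ε * K := by gcongr
    _ ≤ 2 := hεK

lemma odd_step {φ : G → ℝ} (hφ : Good φ) (hφ1 : ∑' g, φ g = 1) (j : ℕ) :
    φ 1 * convPow φ (2 * (j / 2)) 1 ≤ convPow φ j 1 := by
  have hle : φ 1 ≤ 1 := hφ1 ▸ hφ.le_tsum 1
  rcases Nat.mod_two_eq_zero_or_one j with h | h
  · have e : 2 * (j / 2) = j := by omega
    rw [e]
    have := (convPow_good hφ j).nn 1
    nlinarith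
  · obtain ⟨i, hi⟩ : ∃ i, j = i + 1 := ⟨j - 1, by omega⟩
    have e : 2 * (j / 2) = i := by omega
    rw [e, hi]
    have g := convPow_good hφ i
    have h1 := (conv_sm hφ g 1).le_tsum 1 (fun x _ => mul_nonneg (hφ.nn _) (g.nn _))
    simpa [convPow, conv] using h1

end final

/-- main theorem. With `θ₂(s) = θ(s²)/2` and `φ(g) ≃ 1/((1+|g|)^D ℓ(1+|g|²))`,
one has `Φ̃_{G,θ₂}(n) ≃ φ^{(n)}(e)`. -/
theorem statement2 {G : Type*} [Group G] (S : Set G) (hS : IsSymmGen S) (D : ℕ)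
    (hD : PolyGrowth S D) (l : ℝ → ℝ)
    (hlpos : ∀ x, 0 ≤ x → 0 < l x) (hlcont : ContinuousOn l (Set.Ici 0))
    (hlmono : MonotoneOn l (Set.Ici 0)) (hlsv : SlowlyVarying l)
    (hlint : IntegrableOn (fun t => 1 / (t * l t)) (Set.Ioi 1))
    (φ : G → ℝ) (hφ : IsSymmProb φ)
    (c C : ℝ) (hc : 0 < c) (hC : 0 < C)
    (hφbound : ∀ g : G,
      c / ((1 + (wordLen S g : ℝ)) ^ D * l (1 + (wordLen S g : ℝ) ^ 2)) ≤ φ g ∧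
      φ g ≤ C / ((1 + (wordLen S g : ℝ)) ^ D * l (1 + (wordLen S g : ℝ) ^ 2))) :
    ∃ c' C' : ℝ, ∃ N M : ℕ, 0 < c' ∧ 0 < C' ∧ 0 < N ∧ 0 < M ∧
      ∀ n : ℕ,
        c' * convPow φ (2 * N * n) 1 ≤ PhiTilde S (fun s => thetaOf l (s ^ 2) / 2) n ∧
        PhiTilde S (fun s => thetaOf l (s ^ 2) / 2) n ≤ C' * convPow φ (2 * n / M) 1 := by
  obtain ⟨cV, CV, Bs, hb⟩ := ballData hS hD
  have hcV := hb.hcV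
  have hCV := hb.hCV
  obtain ⟨q1, hq1⟩ := exists_nat_ge (2 * CV / cV)
  set q := max 4 q1 with hqdef
  have hq : 4 ≤ q := le_max_left _ _
  have hq0 : (4 : ℝ) ≤ q := by exact_mod_cast hq
  have hqV : 1 ≤ D → 2 * CV ≤ cV * (q : ℝ) ^ D := by
    intro hD1
    have h1 : (q1 : ℝ) ≤ q := by exact_mod_cast le_max_right 4 q1
    have h2 : (q : ℝ) ≤ (q : ℝ) ^ D := le_self_pow₀ (by linarith) (by omega)
    have h3 : 2 * CV / cV ≤ (q : ℝ) ^ D := by linarith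
    rw [div_le_iff₀ hcV] at h3
    linarith
  obtain ⟨c3, c4, j0, hsd⟩ := seqData hlpos hlmono hlsv hlint q hq
  have hm : ModelBound (wordLen S) D l φ c C := hφbound
  have hg : Good φ := ⟨hφ.1, hφ.2.1⟩
  have hφ1 := hφ.2.2.1
  have hc3 := hsd.hc3
  have htail := tail_hi hb hsd hlpos hlmono hC hq hg hm
  have hCt : 0 < CV * (q : ℝ) ^ D * C / c3 := by positivity
  obtain ⟨K, hK, hw⟩ := tail_to_weak hlpos hlmono hlint hq hsd hg hφ1 _ hCt htail
  set ε := min (1 / 2) (2 / K) with hε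
  have hε0 : 0 < ε := by positivity
  have hε1 : ε ≤ 1 := (min_le_left _ _).trans (by norm_num)
  have hεK : ε * K ≤ 2 := by
    have : ε ≤ 2 / K := min_le_right _ _
    rwa [le_div_iff₀ hK] at this
  have hη := lazy_symm hφ ε hε0.le hε1
  have hηw := lazy_weak hε0.le hεK hw
  have hηg : Good (lazy ε φ) := ⟨hη.1, hη.2.1⟩
  have hl1 := hlpos 1 zero_le_one
  have hηm : ModelBound (wordLen S) D l (lazy ε φ) (ε * c) (max C (l 1)) := by
    intro g
    have hp : 0 < (1 + (wordLen S g : ℝ)) ^ D * l (1 + (wordLen S g : ℝ) ^ 2) := by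
      have := hlpos (1 + (wordLen S g : ℝ) ^ 2) (by positivity)
      positivity
    constructor
    · have h1 := mul_le_mul_of_nonneg_left (hm g).1 hε0.le
      rw [mul_div_assoc]
      refine h1.trans ?_
      unfold lazy
      split_ifs <;> linarith
    · by_cases h : g = 1
      · have h1 := hηg.le_tsum g
        rw [hη.2.2.1] at h1
        rw [le_div_iff₀ hp, h, wordLen_one]
        rw [h] at h1
        simp only [Nat.cast_zero, add_zero, one_pow, one_mul, ne_eq, OfNat.ofNat_ne_zero,
          not_false_eq_true, zero_pow]
        calc _ ≤ 1 * l 1 := by gcongr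
          _ ≤ _ := by rw [one_mul]; exact le_max_right _ _
      · have h1 := (hm g).2
        have h2 : lazy ε φ g ≤ φ g := by
          have := hg.nn g
          simp only [lazy, h, if_false]
          nlinarith
        refine h2.trans (h1.trans ?_)
        gcongr
        exact le_max_left _ _
  obtain ⟨N, c', hN, hc', hlow⟩ := compare_main hb hsd hlpos hlmono hlsv hc hC hq hqV hg hφ1 hm
    8 (by norm_num)
  obtain ⟨N', c'', hN', hc'', hupp⟩ := compare_main hb hsd hlpos hlmono hlsv
    (mul_pos hε0 hc) (lt_max_of_lt_left hC) hq hqV hηg hη.2.2.1 hηm _ hCt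
  have hφpos : 0 < φ 1 := by
    refine lt_of_lt_of_le ?_ (hm 1).1
    have := hlpos (1 + (wordLen S (1 : G) : ℝ) ^ 2) (by positivity)
    positivity
  refine ⟨c', 1 / (c'' * φ 1), N, 2 * N', hc', by positivity, hN, by omega, fun n => ⟨?_, ?_⟩⟩
  · refine le_csInf ⟨_, lazy ε φ, hη, hηw, rfl⟩ ?_
    rintro x ⟨μ, hμ, hμw, rfl⟩
    have hμg : Good μ := ⟨hμ.1, hμ.2.1⟩
    exact hlow μ hμg hμ.2.2.1 hμ.2.2.2
      (weak_to_tail hlpos hlmono hlint hq hsd hμg hμw) n (2 * N * n) le_rfl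
  · have h1 : PhiTilde S (fun s => thetaOf l (s ^ 2) / 2) n ≤ convPow (lazy ε φ) (2 * n) 1 := by
      refine csInf_le ⟨0, ?_⟩ ⟨lazy ε φ, hη, hηw, rfl⟩
      rintro x ⟨μ, hμ, _, rfl⟩
      exact (convPow_good ⟨hμ.1, hμ.2.1⟩ _).nn 1
    set j := 2 * n / (2 * N') with hj
    have h2 : 2 * N' * (j / 2) ≤ 2 * n := by
      calc 2 * N' * (j / 2) ≤ 2 * N' * j := by gcongr; exact Nat.div_le_self _ _
        _ ≤ 2 * n := Nat.mul_div_le _ _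
    have h3 := hupp φ hg hφ1 hφ.2.2.2 htail (j / 2) (2 * n) h2
    have h4 := odd_step hg hφ1 j
    refine h1.trans ?_
    rw [div_mul_eq_mul_div, one_mul, le_div_iff₀ (by positivity)]
    calc _ = φ 1 * (c'' * convPow (lazy ε φ) (2 * n) 1) := by ring
      _ ≤ φ 1 * convPow φ (2 * (j / 2)) 1 := by gcongr
      _ ≤ _ := h4
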